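/- Sum capacity in the weak interference regime with dominant backward cross-link: For the deterministic two-hop interference channel with parameters (n, m, f, n̄, m̄) satisfying 3m ≤ 2n and m̄ ≥ n̄, the sum capacity equals C_sum = min{2·max(n−m, m) + 2m̄, 2n − m, 2f}. -/

import Mathlib

open scoped Classical

namespace TwoHopIC

/-- The `q × q` lower-shift matrix `S^k` over `F₂`, with `(S^k)_{i,j} = 1` iff `i = j + k`. -/
def shiftMat (q k : ℕ) : Matrix (Fin q) (Fin q) (ZMod 2) :=
  Matrix.of fun i j => if (i : ℕ) = (j : ℕ) + k then 1 else 0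

/-- Forward (first-hop) signal alphabet: vectors in `F₂^q` with `q = max m n`. -/
abbrev FSig (n m : ℕ) := Fin (max m n) → ZMod 2

/-- Backward/second-hop signal alphabet: vectors in `F₂^q̄` with `q̄ = max(m̄, n̄, f)`. -/
abbrev BSig (f nb mb : ℕ) := Fin (max mb (max nb f)) → ZMod 2

/-- A blocklength-`N` code with message sets of sizes `M1`, `M2`:
causal encoders at the sources (using the messages and the overheard signals),
causal encoders at the relays (using their received signals), and decoders at the
destinations (using the `N` received signals). -/
structure Code (n m f nb mb N M1 M2 : ℕ) where
  encS1 : (t : ℕ) → Fin M1 → (Fin t → BSig f nb mb) → FSig n m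
  encS2 : (t : ℕ) → Fin M2 → (Fin t → BSig f nb mb) → FSig n m
  encR1 : (t : ℕ) → (Fin t → FSig n m) → BSig f nb mb
  encR2 : (t : ℕ) → (Fin t → FSig n m) → BSig f nb mb
  dec1 : (Fin N → BSig f nb mb) → Fin M1
  dec2 : (Fin N → BSig f nb mb) → Fin M2

variable {n m f nb mb N M1 M2 : ℕ}

/-- Given a history `h` of source signals `(X_{S1}[·], X_{S2}[·])`, the signal received by
relay 1 at time `s`: `Y_{R1}[s] = S^{q-n} X_{S1}[s] ⊕ S^{q-m} X_{S2}[s]`. -/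
def relayRx1 (n m : ℕ) {t : ℕ} (h : Fin t → FSig n m × FSig n m) (s : Fin t) : FSig n m :=
  (shiftMat (max m n) (max m n - n)).mulVec (h s).1 +
  (shiftMat (max m n) (max m n - m)).mulVec (h s).2

/-- `Y_{R2}[s] = S^{q-m} X_{S1}[s] ⊕ S^{q-n} X_{S2}[s]`. -/
def relayRx2 (n m : ℕ) {t : ℕ} (h : Fin t → FSig n m × FSig n m) (s : Fin t) : FSig n m :=
  (shiftMat (max m n) (max m n - m)).mulVec (h s).1 +
  (shiftMat (max m n) (max m n - n)).mulVec (h s).2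

/-- Relay 1 transmitted signal `X_{R1}[s]`, a causal function of `Y_{R1}[1..s-1]`. -/
def relayTx1 (C : Code n m f nb mb N M1 M2) {t : ℕ}
    (h : Fin t → FSig n m × FSig n m) (s : Fin t) : BSig f nb mb :=
  C.encR1 s.val (fun u => relayRx1 n m h ⟨u.val, lt_trans u.isLt s.isLt⟩)

/-- Relay 2 transmitted signal `X_{R2}[s]`, a causal function of `Y_{R2}[1..s-1]`. -/
def relayTx2 (C : Code n m f nb mb N M1 M2) {t : ℕ}
    (h : Fin t → FSig n m × FSig n m) (s : Fin t) : BSig f nb mb :=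
  C.encR2 s.val (fun u => relayRx2 n m h ⟨u.val, lt_trans u.isLt s.isLt⟩)

/-- Source 1 overheard signal `Y_{S1}[s] = S^{q̄-n̄} X_{R1}[s] ⊕ S^{q̄-m̄} X_{R2}[s]`. -/
def srcRx1 (C : Code n m f nb mb N M1 M2) {t : ℕ}
    (h : Fin t → FSig n m × FSig n m) (s : Fin t) : BSig f nb mb :=
  (shiftMat (max mb (max nb f)) (max mb (max nb f) - nb)).mulVec (relayTx1 C h s) +
  (shiftMat (max mb (max nb f)) (max mb (max nb f) - mb)).mulVec (relayTx2 C h s)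

/-- Source 2 overheard signal `Y_{S2}[s] = S^{q̄-n̄} X_{R2}[s] ⊕ S^{q̄-m̄} X_{R1}[s]`. -/
def srcRx2 (C : Code n m f nb mb N M1 M2) {t : ℕ}
    (h : Fin t → FSig n m × FSig n m) (s : Fin t) : BSig f nb mb :=
  (shiftMat (max mb (max nb f)) (max mb (max nb f) - nb)).mulVec (relayTx2 C h s) +
  (shiftMat (max mb (max nb f)) (max mb (max nb f) - mb)).mulVec (relayTx1 C h s)

/-- The history `(X_{S1}[1..t], X_{S2}[1..t])` of source signals determined by the
messages `(w1, w2)`: at each time the sources apply their causal encoders to their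
message and the overheard signals so far. -/
def srcHist (C : Code n m f nb mb N M1 M2) (w1 : Fin M1) (w2 : Fin M2) :
    (t : ℕ) → Fin t → FSig n m × FSig n m
  | 0 => fun i => i.elim0
  | t + 1 =>
    Fin.snoc (srcHist C w1 w2 t)
      (C.encS1 t w1 (srcRx1 C (srcHist C w1 w2 t)),
       C.encS2 t w2 (srcRx2 C (srcHist C w1 w2 t)))

/-- `(X_{S1}[t], X_{S2}[t])`. -/
def srcXat (C : Code n m f nb mb N M1 M2) (w1 : Fin M1) (w2 : Fin M2) (t : ℕ) :
    FSig n m × FSig n m :=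
  srcHist C w1 w2 (t + 1) (Fin.last t)

/-- `Y_{R1}[t]`. -/
def relayRxAt1 (C : Code n m f nb mb N M1 M2) (w1 : Fin M1) (w2 : Fin M2) (t : ℕ) :
    FSig n m :=
  relayRx1 n m (srcHist C w1 w2 (t + 1)) (Fin.last t)

/-- `Y_{R2}[t]`. -/
def relayRxAt2 (C : Code n m f nb mb N M1 M2) (w1 : Fin M1) (w2 : Fin M2) (t : ℕ) :
    FSig n m :=
  relayRx2 n m (srcHist C w1 w2 (t + 1)) (Fin.last t)

/-- `X_{R1}[t]`. -/
def relayTxAt1 (C : Code n m f nb mb N M1 M2) (w1 : Fin M1) (w2 : Fin M2) (t : ℕ) :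
    BSig f nb mb :=
  relayTx1 C (srcHist C w1 w2 (t + 1)) (Fin.last t)

/-- `X_{R2}[t]`. -/
def relayTxAt2 (C : Code n m f nb mb N M1 M2) (w1 : Fin M1) (w2 : Fin M2) (t : ℕ) :
    BSig f nb mb :=
  relayTx2 C (srcHist C w1 w2 (t + 1)) (Fin.last t)

/-- `Y_{D1}[t] = S^{q̄-f} X_{R1}[t]`. -/
def destRx1 (C : Code n m f nb mb N M1 M2) (w1 : Fin M1) (w2 : Fin M2) (t : ℕ) :
    BSig f nb mb :=
  (shiftMat (max mb (max nb f)) (max mb (max nb f) - f)).mulVec (relayTxAt1 C w1 w2 t)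

/-- `Y_{D2}[t] = S^{q̄-f} X_{R2}[t]`. -/
def destRx2 (C : Code n m f nb mb N M1 M2) (w1 : Fin M1) (w2 : Fin M2) (t : ℕ) :
    BSig f nb mb :=
  (shiftMat (max mb (max nb f)) (max mb (max nb f) - f)).mulVec (relayTxAt2 C w1 w2 t)

/-- Probability of decoding error under independent uniform messages: since the channel is
deterministic, this is the fraction of message pairs `(w1, w2)` on which some decoder errs. -/
noncomputable def errProb (C : Code n m f nb mb N M1 M2) : ℝ :=
  ((Finset.univ.filter fun w : Fin M1 × Fin M2 =>
      C.dec1 (fun t => destRx1 C w.1 w.2 t.val) ≠ w.1 ∨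
      C.dec2 (fun t => destRx2 C w.1 w.2 t.val) ≠ w.2).card : ℝ) / ((M1 : ℝ) * (M2 : ℝ))

/-- A nonnegative rate pair `(R1, R2)` is achievable if for every `ε > 0` there is a
blocklength `N ≥ 1` and a code with message sets of sizes `⌈2^(N R1)⌉`, `⌈2^(N R2)⌉`
whose probability of error is at most `ε`. -/
def Achievable (n m f nb mb : ℕ) (R1 R2 : ℝ) : Prop :=
  0 ≤ R1 ∧ 0 ≤ R2 ∧
    ∀ ε : ℝ, 0 < ε →
      ∃ N : ℕ, 0 < N ∧
        ∃ C : Code n m f nb mb N ⌈(2 : ℝ) ^ ((N : ℝ) * R1)⌉₊ ⌈(2 : ℝ) ^ ((N : ℝ) * R2)⌉₊,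
          errProb C ≤ ε

/-- The sum capacity `C_sum = sup { R1 + R2 : (R1, R2) achievable }`. -/
noncomputable def sumCapacity (n m f nb mb : ℕ) : ℝ :=
  sSup {r : ℝ | ∃ R1 R2 : ℝ, Achievable n m f nb mb R1 R2 ∧ r = R1 + R2}

end TwoHopIC

/-! ### Entropy of functions on a finite uniform probability space -/

namespace UniformEntropy

variable {Ω α β γ δ : Type*} [Fintype Ω]

/-- The number of sample points on which `X` takes the same value as at `ω`. -/
noncomputable def fiberCard (X : Ω → α) (ω : Ω) : ℕ :=
  (Finset.univ.filter fun ω' => X ω' = X ω).card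

/-- Entropy (in nats) of the random variable `X` under the uniform distribution on `Ω`. -/
noncomputable def entropy (X : Ω → α) : ℝ :=
  Real.log (Fintype.card Ω) - (∑ ω, Real.log (fiberCard X ω)) / Fintype.card Ω

lemma fiberCard_pos (X : Ω → α) (ω : Ω) : 0 < fiberCard X ω :=
  Finset.card_pos.2 ⟨ω, by simp⟩

lemma cast_fiberCard_pos (X : Ω → α) (ω : Ω) : (0 : ℝ) < fiberCard X ω :=
  Nat.cast_pos.2 (fiberCard_pos X ω)

lemma cast_fiberCard (X : Ω → α) (ω : Ω) :
    (fiberCard X ω : ℝ) = ∑ ω', if X ω' = X ω then 1 else 0 := by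
  simp [fiberCard]

lemma fiberCard_congr {X : Ω → α} {ω ω' : Ω} (h : X ω = X ω') :
    fiberCard X ω = fiberCard X ω' := by
  simp only [fiberCard, h]

lemma entropy_mono {X : Ω → α} {Y : Ω → β} (h : ∀ ω ω', X ω = X ω' → Y ω = Y ω') :
    entropy Y ≤ entropy X := by
  have key : ∑ ω, Real.log (fiberCard X ω) ≤ ∑ ω, Real.log (fiberCard Y ω) := by
    refine Finset.sum_le_sum fun ω _ => Real.log_le_log ?_ ?_
    · exact cast_fiberCard_pos X ω
    · refine Nat.cast_le.2 (Finset.card_le_card fun ω' hω' => ?_)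
      simp only [Finset.mem_filter, Finset.mem_univ, true_and] at hω' ⊢
      exact h _ _ hω'
  unfold entropy
  gcongr

/-- Entropy of an injective variable. -/
lemma entropy_of_injective {X : Ω → α} (h : Function.Injective X) :
    entropy X = Real.log (Fintype.card Ω) := by
  have : ∀ ω, fiberCard X ω = 1 := fun ω =>
    Finset.card_eq_one.2 ⟨ω, by ext; simp [h.eq_iff]⟩
  simp [entropy, this]

/-- Gibbs' inequality: the entropy is at most the cross entropy with a subprobability. -/
lemma entropy_le_crossEntropy [Nonempty Ω] [Fintype α] (X : Ω → α) (p : α → ℝ)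
    (hp : ∀ v, 0 < p v) (hsum : ∑ v, p v ≤ 1) :
    entropy X ≤ -(∑ ω, Real.log (p (X ω))) / Fintype.card Ω := by
  have hc : (0 : ℝ) < Fintype.card Ω := by exact_mod_cast Fintype.card_pos
  have hmass : ∑ ω, p (X ω) / fiberCard X ω ≤ 1 := by
    rw [← Finset.sum_fiberwise Finset.univ X]
    refine le_trans (Finset.sum_le_sum fun v _ => ?_) hsum
    have : ∀ ω ∈ Finset.univ.filter (fun ω => X ω = v), p (X ω) / fiberCard X ω =
        p v / (Finset.univ.filter fun ω => X ω = v).card := by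
      intro ω hω
      have hv : X ω = v := by simpa using hω
      simp [fiberCard, hv]
    rw [Finset.sum_congr rfl this, Finset.sum_const, nsmul_eq_mul]
    rcases Nat.eq_zero_or_pos (Finset.univ.filter fun ω => X ω = v).card with h0 | h0
    · simp [h0, (hp v).le]
    · have h0' : ((Finset.univ.filter fun ω => X ω = v).card : ℝ) ≠ 0 := by
        exact_mod_cast h0.ne'
      rw [mul_div_cancel₀ _ h0']
  have hpt : ∀ ω, Real.log (Fintype.card Ω) - Real.log (fiberCard X ω) + Real.log (p (X ω)) ≤
      Fintype.card Ω * (p (X ω) / fiberCard X ω) - 1 := by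
    intro ω
    have hf : (0 : ℝ) < fiberCard X ω := cast_fiberCard_pos X ω
    have := hp (X ω)
    rw [← Real.log_div hc.ne' hf.ne', ← Real.log_mul (by positivity) this.ne']
    refine (Real.log_le_sub_one_of_pos (by positivity)).trans (le_of_eq ?_)
    ring
  have htot := Finset.sum_le_sum fun ω (_ : ω ∈ Finset.univ) => hpt ω
  simp only [Finset.sum_add_distrib, Finset.sum_sub_distrib, ← Finset.mul_sum,
    Finset.sum_const, Finset.card_univ, nsmul_eq_mul, mul_one] at htot
  unfold entropy
  rw [le_div_iff₀ hc, sub_mul, div_mul_cancel₀ _ hc.ne']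
  nlinarith

lemma entropy_le_log_card [Nonempty Ω] [Fintype α] (X : Ω → α) :
    entropy X ≤ Real.log (Fintype.card α) := by
  have hc : (0 : ℝ) < Fintype.card Ω := by exact_mod_cast Fintype.card_pos
  have : Nonempty α := Nonempty.map X inferInstance
  have ha : (0 : ℝ) < Fintype.card α := by exact_mod_cast Fintype.card_pos
  have h := entropy_le_crossEntropy X (fun _ => ((Fintype.card α : ℝ))⁻¹)
    (fun _ => by positivity) (by simp [ha.ne'])
  simpa [hc.ne'] using h

/-- Submodularity: if `S` and `T` jointly determine `J` and each of them determines `I`,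
then `H(J) + H(I) ≤ H(S) + H(T)`. -/
lemma entropy_submodular [Nonempty Ω] {J : Ω → α} {I : Ω → β} {S : Ω → γ} {T : Ω → δ}
    (hJ : ∀ ω ω', S ω = S ω' → T ω = T ω' → J ω = J ω')
    (hS : ∀ ω ω', S ω = S ω' → I ω = I ω') (hT : ∀ ω ω', T ω = T ω' → I ω = I ω') :
    entropy J + entropy I ≤ entropy S + entropy T := by
  have hc : (0 : ℝ) < Fintype.card Ω := by exact_mod_cast Fintype.card_pos
  set P : Ω → γ × δ := fun ω => (S ω, T ω)
  have hJP : entropy J ≤ entropy P :=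
    entropy_mono fun ω ω' h => hJ ω ω' (congrArg Prod.fst h) (congrArg Prod.snd h)
  have hcls : ∀ ω₁ ω₂ : Ω, ∑ ω, (if S ω₁ = S ω ∧ T ω₂ = T ω then
      ((fiberCard I ω : ℝ) * fiberCard P ω)⁻¹ else 0) ≤
      if I ω₂ = I ω₁ then (fiberCard I ω₁ : ℝ)⁻¹ else 0 := by
    intro ω₁ ω₂
    by_cases hex : ∃ ω, S ω₁ = S ω ∧ T ω₂ = T ω
    · obtain ⟨ω₀, hS₀, hT₀⟩ := hex
      have h12 : I ω₂ = I ω₁ := (hT _ _ hT₀).trans (hS _ _ hS₀).symm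
      have hterm : ∀ ω, (if S ω₁ = S ω ∧ T ω₂ = T ω then
          ((fiberCard I ω : ℝ) * fiberCard P ω)⁻¹ else 0) =
          (if P ω = P ω₀ then 1 else 0) * ((fiberCard I ω₁ : ℝ) * fiberCard P ω₀)⁻¹ := by
        intro ω
        by_cases hω : S ω₁ = S ω ∧ T ω₂ = T ω
        · have hP : P ω = P ω₀ :=
            Prod.ext (hω.1.symm.trans hS₀) (hω.2.symm.trans hT₀)
          rw [if_pos hω, if_pos hP, one_mul, fiberCard_congr hP,
            fiberCard_congr (hS _ _ hω.1)]
        · have hP : P ω ≠ P ω₀ := fun h => hω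
            ⟨hS₀.trans (congrArg Prod.fst h).symm, hT₀.trans (congrArg Prod.snd h).symm⟩
          rw [if_neg hω, if_neg hP, zero_mul]
      have hcard : ∑ ω, (if P ω = P ω₀ then (1 : ℝ) else 0) = fiberCard P ω₀ := by
        rw [cast_fiberCard]
        congr!
      rw [Finset.sum_congr rfl fun ω _ => hterm ω, ← Finset.sum_mul, hcard,
        if_pos h12, mul_inv]
      have := (cast_fiberCard_pos P ω₀).ne'
      rw [mul_left_comm, mul_inv_cancel₀ this, mul_one]
    · rw [Finset.sum_eq_zero fun ω _ => if_neg fun h => hex ⟨ω, h⟩]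
      split_ifs <;> positivity
  have hmass : ∑ ω, (fiberCard S ω : ℝ) * fiberCard T ω / (fiberCard I ω * fiberCard P ω) ≤
      Fintype.card Ω := by
    calc ∑ ω, (fiberCard S ω : ℝ) * fiberCard T ω / (fiberCard I ω * fiberCard P ω)
        = ∑ ω, ∑ ω₁, ∑ ω₂, (if S ω₁ = S ω ∧ T ω₂ = T ω then
            ((fiberCard I ω : ℝ) * fiberCard P ω)⁻¹ else 0) := by
          refine Finset.sum_congr rfl fun ω _ => ?_
          rw [cast_fiberCard S, cast_fiberCard T, div_eq_mul_inv, Finset.sum_mul_sum,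
            Finset.sum_mul]
          refine Finset.sum_congr rfl fun ω₁ _ => ?_
          rw [Finset.sum_mul]
          refine Finset.sum_congr rfl fun ω₂ _ => ?_
          by_cases h : S ω₁ = S ω <;> by_cases h' : T ω₂ = T ω <;> simp [h, h']
      _ = ∑ ω₁, ∑ ω₂, ∑ ω, (if S ω₁ = S ω ∧ T ω₂ = T ω then
            ((fiberCard I ω : ℝ) * fiberCard P ω)⁻¹ else 0) := by
          rw [Finset.sum_comm]
          exact Finset.sum_congr rfl fun ω₁ _ => Finset.sum_comm
      _ ≤ ∑ ω₁, ∑ ω₂, if I ω₂ = I ω₁ then (fiberCard I ω₁ : ℝ)⁻¹ else 0 :=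
          Finset.sum_le_sum fun ω₁ _ => Finset.sum_le_sum fun ω₂ _ => hcls ω₁ ω₂
      _ = ∑ _ω₁ : Ω, (1 : ℝ) := by
          refine Finset.sum_congr rfl fun ω₁ _ => ?_
          have := (cast_fiberCard_pos I ω₁).ne'
          rw [← mul_inv_cancel₀ this, cast_fiberCard I ω₁, Finset.sum_mul]
          refine Finset.sum_congr rfl fun ω₂ _ => ?_
          by_cases h : I ω₂ = I ω₁ <;> simp [h]
      _ = Fintype.card Ω := by simp
  have hpt : ∀ ω, Real.log (fiberCard S ω) + Real.log (fiberCard T ω) -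
      (Real.log (fiberCard I ω) + Real.log (fiberCard P ω)) ≤
      (fiberCard S ω : ℝ) * fiberCard T ω / (fiberCard I ω * fiberCard P ω) - 1 := by
    intro ω
    have hs := cast_fiberCard_pos S ω
    have ht := cast_fiberCard_pos T ω
    have hi := cast_fiberCard_pos I ω
    have hj := cast_fiberCard_pos P ω
    rw [← Real.log_mul hs.ne' ht.ne', ← Real.log_mul hi.ne' hj.ne',
      ← Real.log_div (by positivity) (by positivity)]
    exact Real.log_le_sub_one_of_pos (by positivity)
  have htot := Finset.sum_le_sum fun ω (_ : ω ∈ Finset.univ) => hpt ω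
  simp only [Finset.sum_add_distrib, Finset.sum_sub_distrib, Finset.sum_const,
    Finset.card_univ, nsmul_eq_mul, mul_one] at htot
  refine (add_le_add_left hJP _).trans ?_
  have hdiv : (∑ ω, Real.log (fiberCard S ω)) / Fintype.card Ω +
      (∑ ω, Real.log (fiberCard T ω)) / Fintype.card Ω ≤
      (∑ ω, Real.log (fiberCard I ω)) / Fintype.card Ω +
      (∑ ω, Real.log (fiberCard P ω)) / Fintype.card Ω := by
    rw [← add_div, ← add_div]
    exact div_le_div_of_nonneg_right (by linarith) hc.le
  unfold entropy
  linarith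

lemma entropy_pair_le [Nonempty Ω] (X : Ω → α) (Y : Ω → β) :
    entropy (fun ω => (X ω, Y ω)) ≤ entropy X + entropy Y := by
  have h := entropy_submodular (J := fun ω => (X ω, Y ω)) (I := fun _ => ()) (S := X) (T := Y)
    (fun ω ω' h h' => Prod.ext h h') (fun _ _ _ => rfl) (fun _ _ _ => rfl)
  have h0 : entropy (fun _ : Ω => ()) = 0 := by
    have hc : (0 : ℝ) < Fintype.card Ω := by exact_mod_cast Fintype.card_pos
    simp [entropy, fiberCard, hc.ne']
  linarith

/-- If `X` and `Y` determine `Z`, then `H(Z) ≤ H(X) + H(Y)`. -/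
lemma entropy_le_add [Nonempty Ω] {X : Ω → α} {Y : Ω → β} {Z : Ω → γ}
    (h : ∀ ω ω', X ω = X ω' → Y ω = Y ω' → Z ω = Z ω') :
    entropy Z ≤ entropy X + entropy Y :=
  (entropy_mono fun ω ω' e => h ω ω' (congrArg Prod.fst e) (congrArg Prod.snd e)).trans
    (entropy_pair_le X Y)

lemma entropy_fst [Fintype α] [Fintype β] [Nonempty α] [Nonempty β] :
    entropy (Prod.fst : α × β → α) = Real.log (Fintype.card α) := by
  have hα : (0 : ℝ) < Fintype.card α := by exact_mod_cast Fintype.card_pos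
  have hβ : (0 : ℝ) < Fintype.card β := by exact_mod_cast Fintype.card_pos
  refine le_antisymm (entropy_le_log_card _) ?_
  have h := entropy_pair_le (Prod.fst : α × β → α) Prod.snd
  have h1 := entropy_of_injective (X := fun ω : α × β => (ω.1, ω.2)) fun _ _ h => h
  have h2 := entropy_le_log_card (Prod.snd : α × β → β)
  rw [h1, Fintype.card_prod, Nat.cast_mul, Real.log_mul hα.ne' hβ.ne'] at h
  linarith

lemma entropy_snd [Fintype α] [Fintype β] [Nonempty α] [Nonempty β] :
    entropy (Prod.snd : α × β → β) = Real.log (Fintype.card β) := by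
  have hα : (0 : ℝ) < Fintype.card α := by exact_mod_cast Fintype.card_pos
  have hβ : (0 : ℝ) < Fintype.card β := by exact_mod_cast Fintype.card_pos
  refine le_antisymm (entropy_le_log_card _) ?_
  have h := entropy_pair_le (Prod.fst : α × β → α) Prod.snd
  have h1 := entropy_of_injective (X := fun ω : α × β => (ω.1, ω.2)) fun _ _ h => h
  rw [h1, entropy_fst, Fintype.card_prod, Nat.cast_mul, Real.log_mul hα.ne' hβ.ne'] at h
  linarith

/-- The error term of Fano's inequality for an alphabet with `M` letters. -/
noncomputable def fanoTerm (ε : ℝ) (M : ℕ) : ℝ :=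
  ε * Real.log M + (-Real.log (1 - ε) - ε * Real.log ε)

/-- Fano's inequality: `g` guesses `W` up to an error event of probability at most `ε`. Here it
is phrased through a variable `V` that, jointly with the guess, determines `W`. -/
lemma fano [Nonempty Ω] {M : ℕ} (W G : Ω → Fin M) {ε : ℝ} (h0 : 0 < ε) (h1 : ε < 1)
    (herr : ((Finset.univ.filter fun ω => G ω ≠ W ω).card : ℝ) ≤ ε * Fintype.card Ω) :
    entropy (fun ω => if G ω = W ω then none else some (W ω)) ≤ fanoTerm ε M := by
  have hc : (0 : ℝ) < Fintype.card Ω := by exact_mod_cast Fintype.card_pos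
  have hM : 0 < M := (W (Classical.arbitrary Ω)).pos
  have hM' : (1 : ℝ) ≤ M := by exact_mod_cast hM
  have hM0 : (0 : ℝ) < M := by linarith
  let p : Option (Fin M) → ℝ := fun v => v.elim (1 - ε) fun _ => ε / M
  have hp : ∀ v, 0 < p v := by
    rintro (_ | v)
    · exact sub_pos.2 h1
    · exact div_pos h0 hM0
  have hsum : ∑ v, p v ≤ 1 := by
    rw [Fintype.sum_option]
    simp [p]
    field_simp
    simp
  have h := entropy_le_crossEntropy (fun ω => if G ω = W ω then none else some (W ω)) p hp hsum
  refine h.trans ?_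
  have hpt : ∀ ω, -Real.log (p (if G ω = W ω then none else some (W ω))) ≤
      -Real.log (1 - ε) + (Real.log M - Real.log ε) * (if G ω ≠ W ω then 1 else 0) := by
    intro ω
    have hl : Real.log (1 - ε) ≤ 0 := Real.log_nonpos (by linarith) (by linarith)
    by_cases hω : G ω = W ω
    · simp [hω, p]
    · simp only [hω, if_false, p, Option.elim, ne_eq, not_false_eq_true, if_true, mul_one]
      rw [Real.log_div h0.ne' hM0.ne']
      linarith
  have htot := Finset.sum_le_sum fun ω (_ : ω ∈ Finset.univ) => hpt ω
  rw [Finset.sum_neg_distrib, Finset.sum_add_distrib, ← Finset.mul_sum, Finset.sum_const,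
    Finset.sum_boole, nsmul_eq_mul, Finset.card_univ] at htot
  rw [div_le_iff₀ hc]
  refine htot.trans ?_
  have hl : 0 ≤ Real.log M - Real.log ε := by
    have := Real.log_nonneg hM'
    have := Real.log_nonpos h0.le h1.le
    linarith
  have := mul_le_mul_of_nonneg_left herr hl
  unfold fanoTerm
  linarith

end UniformEntropy

/-! ### The signals of a code as sequences in time -/

namespace TwoHopIC

section Signals

lemma shiftMat_mulVec (q k : ℕ) (v : Fin q → ZMod 2) (i : Fin q) :
    (shiftMat q k).mulVec v i =
      if k ≤ (i : ℕ) then v ⟨i - k, lt_of_le_of_lt (Nat.sub_le _ _) i.isLt⟩ else 0 := by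
  simp only [Matrix.mulVec, dotProduct, shiftMat, Matrix.of_apply, ite_mul, one_mul, zero_mul]
  split_ifs with h
  · rw [Finset.sum_eq_single ⟨i - k, lt_of_le_of_lt (Nat.sub_le _ _) i.isLt⟩]
    · rw [if_pos]
      simp only
      omega
    · intro j _ hj
      rw [if_neg]
      intro h'
      exact hj (Fin.ext (by simp only; omega))
    · simp
  · exact Finset.sum_eq_zero fun j _ => if_neg (by omega)

variable {n m f nb mb N M1 M2 : ℕ}

/-- `Y_{S1}[t]`. -/
def srcRxAt1 (C : Code n m f nb mb N M1 M2) (w1 : Fin M1) (w2 : Fin M2) (t : ℕ) :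
    BSig f nb mb :=
  (shiftMat (max mb (max nb f)) (max mb (max nb f) - nb)).mulVec (relayTxAt1 C w1 w2 t) +
  (shiftMat (max mb (max nb f)) (max mb (max nb f) - mb)).mulVec (relayTxAt2 C w1 w2 t)

/-- `Y_{S2}[t]`. -/
def srcRxAt2 (C : Code n m f nb mb N M1 M2) (w1 : Fin M1) (w2 : Fin M2) (t : ℕ) :
    BSig f nb mb :=
  (shiftMat (max mb (max nb f)) (max mb (max nb f) - nb)).mulVec (relayTxAt2 C w1 w2 t) +
  (shiftMat (max mb (max nb f)) (max mb (max nb f) - mb)).mulVec (relayTxAt1 C w1 w2 t)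

variable (C : Code n m f nb mb N M1 M2) (w1 : Fin M1) (w2 : Fin M2)

lemma srcHist_apply (t : ℕ) (s : Fin t) : srcHist C w1 w2 t s = srcXat C w1 w2 s := by
  induction t with
  | zero => exact s.elim0
  | succ t ih =>
    refine Fin.lastCases ?_ (fun s => ?_) s
    · rfl
    · rw [srcHist, Fin.snoc_castSucc]
      exact ih s

lemma relayRxAt1_eq (t : ℕ) : relayRxAt1 C w1 w2 t =
    (shiftMat (max m n) (max m n - n)).mulVec (srcXat C w1 w2 t).1 +
    (shiftMat (max m n) (max m n - m)).mulVec (srcXat C w1 w2 t).2 := rfl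

lemma relayRxAt2_eq (t : ℕ) : relayRxAt2 C w1 w2 t =
    (shiftMat (max m n) (max m n - m)).mulVec (srcXat C w1 w2 t).1 +
    (shiftMat (max m n) (max m n - n)).mulVec (srcXat C w1 w2 t).2 := rfl

lemma relayTx1_srcHist {t : ℕ} (s : Fin t) : relayTx1 C (srcHist C w1 w2 t) s =
    C.encR1 s fun u => relayRxAt1 C w1 w2 u := by
  simp only [relayTx1, relayRx1, relayRxAt1, srcHist_apply, Fin.val_last]

lemma relayTx2_srcHist {t : ℕ} (s : Fin t) : relayTx2 C (srcHist C w1 w2 t) s =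
    C.encR2 s fun u => relayRxAt2 C w1 w2 u := by
  simp only [relayTx2, relayRx2, relayRxAt2, srcHist_apply, Fin.val_last]

lemma relayTxAt1_eq (t : ℕ) :
    relayTxAt1 C w1 w2 t = C.encR1 t fun u => relayRxAt1 C w1 w2 u :=
  relayTx1_srcHist C w1 w2 (Fin.last t)

lemma relayTxAt2_eq (t : ℕ) :
    relayTxAt2 C w1 w2 t = C.encR2 t fun u => relayRxAt2 C w1 w2 u :=
  relayTx2_srcHist C w1 w2 (Fin.last t)

lemma srcXat_fst (t : ℕ) :
    (srcXat C w1 w2 t).1 = C.encS1 t w1 fun u => srcRxAt1 C w1 w2 u := by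
  simp only [srcXat, srcHist, Fin.snoc_last]
  congr 1
  funext u
  simp only [srcRx1, srcRxAt1, relayTx1_srcHist, relayTx2_srcHist, relayTxAt1_eq, relayTxAt2_eq]

lemma srcXat_snd (t : ℕ) :
    (srcXat C w1 w2 t).2 = C.encS2 t w2 fun u => srcRxAt2 C w1 w2 u := by
  simp only [srcXat, srcHist, Fin.snoc_last]
  congr 1
  funext u
  simp only [srcRx2, srcRxAt2, relayTx1_srcHist, relayTx2_srcHist, relayTxAt1_eq, relayTxAt2_eq]

/-- The code with the roles of the two users exchanged. -/
def Code.swap (C : Code n m f nb mb N M1 M2) : Code n m f nb mb N M2 M1 where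
  encS1 := C.encS2
  encS2 := C.encS1
  encR1 := C.encR2
  encR2 := C.encR1
  dec1 := C.dec2
  dec2 := C.dec1

lemma srcXat_swap (t : ℕ) : srcXat C.swap w2 w1 t = (srcXat C w1 w2 t).swap := by
  induction t using Nat.strong_induction_on with
  | _ t ih =>
    have hR1 : ∀ u < t, relayRxAt1 C.swap w2 w1 u = relayRxAt2 C w1 w2 u := fun u hu => by
      rw [relayRxAt1_eq, relayRxAt2_eq, ih u hu, add_comm]; rfl
    have hR2 : ∀ u < t, relayRxAt2 C.swap w2 w1 u = relayRxAt1 C w1 w2 u := fun u hu => by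
      rw [relayRxAt2_eq, relayRxAt1_eq, ih u hu, add_comm]; rfl
    have hT1 : ∀ u < t, relayTxAt1 C.swap w2 w1 u = relayTxAt2 C w1 w2 u := fun u hu => by
      rw [relayTxAt1_eq, relayTxAt2_eq]
      exact congrArg (C.encR2 u) (funext fun v => hR1 v (v.isLt.trans hu))
    have hT2 : ∀ u < t, relayTxAt2 C.swap w2 w1 u = relayTxAt1 C w1 w2 u := fun u hu => by
      rw [relayTxAt1_eq, relayTxAt2_eq]
      exact congrArg (C.encR1 u) (funext fun v => hR2 v (v.isLt.trans hu))
    refine Prod.ext ?_ ?_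
    · rw [Prod.fst_swap, srcXat_fst, srcXat_snd]
      refine congrArg (C.encS2 t w2) (funext fun u => ?_)
      simp only [srcRxAt1, srcRxAt2, hT1 u u.isLt, hT2 u u.isLt]
    · rw [Prod.snd_swap, srcXat_fst, srcXat_snd]
      refine congrArg (C.encS1 t w1) (funext fun u => ?_)
      simp only [srcRxAt1, srcRxAt2, hT1 u u.isLt, hT2 u u.isLt]

lemma relayRxAt1_swap (t : ℕ) : relayRxAt1 C.swap w2 w1 t = relayRxAt2 C w1 w2 t := by
  rw [relayRxAt1_eq, relayRxAt2_eq, srcXat_swap, add_comm]; rfl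

lemma relayRxAt2_swap (t : ℕ) : relayRxAt2 C.swap w2 w1 t = relayRxAt1 C w1 w2 t := by
  rw [relayRxAt1_eq, relayRxAt2_eq, srcXat_swap, add_comm]; rfl

lemma relayTxAt1_swap (t : ℕ) : relayTxAt1 C.swap w2 w1 t = relayTxAt2 C w1 w2 t := by
  simp only [relayTxAt1_eq, relayTxAt2_eq, relayRxAt1_swap]; rfl

lemma relayTxAt2_swap (t : ℕ) : relayTxAt2 C.swap w2 w1 t = relayTxAt1 C w1 w2 t := by
  simp only [relayTxAt1_eq, relayTxAt2_eq, relayRxAt2_swap]; rfl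

lemma srcRxAt1_swap (t : ℕ) : srcRxAt1 C.swap w2 w1 t = srcRxAt2 C w1 w2 t := by
  simp only [srcRxAt1, srcRxAt2, relayTxAt1_swap, relayTxAt2_swap]

lemma srcRxAt2_swap (t : ℕ) : srcRxAt2 C.swap w2 w1 t = srcRxAt1 C w1 w2 t := by
  simp only [srcRxAt1, srcRxAt2, relayTxAt1_swap, relayTxAt2_swap]

lemma destRx1_swap (t : ℕ) : destRx1 C.swap w2 w1 t = destRx2 C w1 w2 t := by
  simp only [destRx1, destRx2, relayTxAt1_swap]

/-- The part of `X_{S1}[t]` that interferes at relay 2, at the levels where it is received. -/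
def interf1 (C : Code n m f nb mb N M1 M2) (w1 : Fin M1) (w2 : Fin M2) (t : ℕ) : FSig n m :=
  (shiftMat (max m n) (max m n - m)).mulVec (srcXat C w1 w2 t).1

/-- The part of `X_{S2}[t]` that interferes at relay 1, at the levels where it is received. -/
def interf2 (C : Code n m f nb mb N M1 M2) (w1 : Fin M1) (w2 : Fin M2) (t : ℕ) : FSig n m :=
  (shiftMat (max m n) (max m n - m)).mulVec (srcXat C w1 w2 t).2

lemma interf1_swap (t : ℕ) : interf1 C.swap w2 w1 t = interf2 C w1 w2 t := by
  rw [interf1, interf2, srcXat_swap]; rfl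

lemma interf2_swap (t : ℕ) : interf2 C.swap w2 w1 t = interf1 C w1 w2 t := by
  rw [interf1, interf2, srcXat_swap]; rfl

/-- The lowest `k` of the levels of a signal. -/
def lowLevels (k : ℕ) {q : ℕ} (v : Fin q → ZMod 2) (j : Fin k) : ZMod 2 :=
  if h : q - k + j < q then v ⟨q - k + j, h⟩ else 0

lemma eq_of_lowLevels_eq {k q : ℕ} {v v' : Fin q → ZMod 2} (h : lowLevels k v = lowLevels k v')
    (htop : ∀ i : Fin q, (i : ℕ) < q - k → v i = v' i) : v = v' := by
  funext i
  by_cases hi : (i : ℕ) < q - k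
  · exact htop i hi
  · have := congrFun h ⟨i - (q - k), by omega⟩
    have hi' : q - k + ((i : ℕ) - (q - k)) = i := by omega
    simpa [lowLevels, hi'] using this

section Determination

variable {C w1 w2} {v1 : Fin M1} {v2 : Fin M2}

lemma srcXat_fst_determined {T : ℕ} (hw : w1 = v1)
    (hA : ∀ t < T, srcRxAt1 C w1 w2 t = srcRxAt1 C v1 v2 t) :
    ∀ t ≤ T, (srcXat C w1 w2 t).1 = (srcXat C v1 v2 t).1 := by
  intro t ht
  rw [srcXat_fst, srcXat_fst, ← hw]
  exact congrArg (C.encS1 t w1) (funext fun u => by rw [hA u (by omega), hw])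

lemma relayTxAt1_determined {T : ℕ}
    (hY : ∀ t < T, relayRxAt1 C w1 w2 t = relayRxAt1 C v1 v2 t) :
    ∀ t ≤ T, relayTxAt1 C w1 w2 t = relayTxAt1 C v1 v2 t := by
  intro t ht
  rw [relayTxAt1_eq, relayTxAt1_eq]
  exact congrArg (C.encR1 t) (funext fun u => hY u (by omega))

/-- A relay that knows what its own source sent knows the interference. -/
lemma interf2_determined {t : ℕ} (hX : (srcXat C w1 w2 t).1 = (srcXat C v1 v2 t).1)
    (hY : relayRxAt1 C w1 w2 t = relayRxAt1 C v1 v2 t) :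
    interf2 C w1 w2 t = interf2 C v1 v2 t := by
  rw [relayRxAt1_eq, relayRxAt1_eq, hX] at hY
  exact add_left_cancel hY

/-- The top levels of the received signal are interference free. -/
lemma relayRxAt1_determined (hmn : m ≤ n) {t : ℕ}
    (hV : interf1 C w1 w2 t = interf1 C v1 v2 t)
    (hL : lowLevels (max (n - m) m) (relayRxAt1 C w1 w2 t) =
      lowLevels (max (n - m) m) (relayRxAt1 C v1 v2 t)) :
    relayRxAt1 C w1 w2 t = relayRxAt1 C v1 v2 t := by
  refine eq_of_lowLevels_eq hL fun i hi => ?_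
  have h := congrFun hV ⟨i + (max m n - m), by omega⟩
  simp only [interf1, shiftMat_mulVec] at h
  rw [if_pos (by omega), if_pos (by omega)] at h
  simp only [relayRxAt1_eq, Pi.add_apply, shiftMat_mulVec]
  rw [if_pos (by omega), if_neg (by omega), if_pos (by omega), if_neg (by omega)]
  have hi' : (i : ℕ) - (max m n - n) = i + (max m n - m) - (max m n - m) := by omega
  simp only [hi']
  rw [h]

/-- With a dominant backward cross link, source 2 can reconstruct what source 1 overhears
once it knows the interference at its own relay. -/
lemma srcRxAt1_determined (h2 : nb ≤ mb) {T : ℕ} (hw : w2 = v2)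
    (hV : ∀ t < T, interf1 C w1 w2 t = interf1 C v1 v2 t)
    (hB : ∀ t < T, srcRxAt2 C w1 w2 t = srcRxAt2 C v1 v2 t) :
    ∀ t < T, srcRxAt1 C w1 w2 t = srcRxAt1 C v1 v2 t := by
  have hX : ∀ t < T, (srcXat C w1 w2 t).2 = (srcXat C v1 v2 t).2 := by
    intro t ht
    rw [srcXat_snd, srcXat_snd, ← hw]
    exact congrArg (C.encS2 t w2) (funext fun u => by rw [hB u (by omega), hw])
  have hY : ∀ t < T, relayRxAt2 C w1 w2 t = relayRxAt2 C v1 v2 t := by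
    intro t ht
    have := hV t ht
    simp only [interf1] at this
    rw [relayRxAt2_eq, relayRxAt2_eq, hX t ht, this]
  have hR : ∀ t < T, relayTxAt2 C w1 w2 t = relayTxAt2 C v1 v2 t := by
    intro t ht
    rw [relayTxAt2_eq, relayTxAt2_eq]
    exact congrArg (C.encR2 t) (funext fun u => hY u (by omega))
  intro t ht
  have hb := hB t ht
  simp only [srcRxAt2, hR t ht] at hb
  have hc := add_left_cancel hb
  simp only [srcRxAt1, hR t ht]
  congr 1
  funext i
  simp only [shiftMat_mulVec]
  split_ifs with hi
  · have := congrFun hc ⟨i - (mb - nb), by omega⟩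
    simp only [shiftMat_mulVec] at this
    rw [if_pos (by omega), if_pos (by omega)] at this
    have hi' : (i : ℕ) - (mb - nb) - (max mb (max nb f) - mb) = i - (max mb (max nb f) - nb) := by
      omega
    simpa only [hi'] using this
  · rfl

lemma srcRxAt1_eq_of_lowLevels (h2 : nb ≤ mb) {t : ℕ}
    (h : lowLevels mb (srcRxAt1 C w1 w2 t) = lowLevels mb (srcRxAt1 C v1 v2 t)) :
    srcRxAt1 C w1 w2 t = srcRxAt1 C v1 v2 t := by
  refine eq_of_lowLevels_eq h fun i hi => ?_
  simp only [srcRxAt1, Pi.add_apply, shiftMat_mulVec]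
  rw [if_neg (by omega), if_neg (by omega), if_neg (by omega), if_neg (by omega)]

lemma srcXat_snd_determined {T : ℕ} (hw : w2 = v2)
    (hB : ∀ t < T, srcRxAt2 C w1 w2 t = srcRxAt2 C v1 v2 t) :
    ∀ t ≤ T, (srcXat C w1 w2 t).2 = (srcXat C v1 v2 t).2 := by
  simpa only [srcRxAt1_swap, srcXat_swap, Prod.fst_swap] using
    srcXat_fst_determined (C := C.swap) (w2 := w1) (v2 := v1) (T := T) hw
      (by simpa only [srcRxAt1_swap] using hB)

lemma interf1_determined {t : ℕ} (hX : (srcXat C w1 w2 t).2 = (srcXat C v1 v2 t).2)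
    (hY : relayRxAt2 C w1 w2 t = relayRxAt2 C v1 v2 t) :
    interf1 C w1 w2 t = interf1 C v1 v2 t := by
  rw [← interf2_swap, ← interf2_swap]
  rw [← relayRxAt1_swap, ← relayRxAt1_swap] at hY
  exact interf2_determined (by simpa only [srcXat_swap, Prod.fst_swap] using hX) hY

lemma relayRxAt2_determined_of_interf (hmn : m ≤ n) {t : ℕ}
    (hV : interf2 C w1 w2 t = interf2 C v1 v2 t)
    (hL : lowLevels (max (n - m) m) (relayRxAt2 C w1 w2 t) =
      lowLevels (max (n - m) m) (relayRxAt2 C v1 v2 t)) :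
    relayRxAt2 C w1 w2 t = relayRxAt2 C v1 v2 t := by
  simp only [← interf1_swap] at hV
  simp only [← relayRxAt1_swap] at hL ⊢
  exact relayRxAt1_determined hmn hV hL

lemma srcRxAt2_determined (h2 : nb ≤ mb) {T : ℕ} (hw : w1 = v1)
    (hV : ∀ t < T, interf2 C w1 w2 t = interf2 C v1 v2 t)
    (hA : ∀ t < T, srcRxAt1 C w1 w2 t = srcRxAt1 C v1 v2 t) :
    ∀ t < T, srcRxAt2 C w1 w2 t = srcRxAt2 C v1 v2 t := by
  simp only [← interf1_swap] at hV
  simp only [← srcRxAt2_swap] at hA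
  simp only [← srcRxAt1_swap]
  exact srcRxAt1_determined h2 hw hV hA

lemma destRx1_eq_of_lowLevels {t : ℕ}
    (h : lowLevels f (destRx1 C w1 w2 t) = lowLevels f (destRx1 C v1 v2 t)) :
    destRx1 C w1 w2 t = destRx1 C v1 v2 t := by
  refine eq_of_lowLevels_eq h fun i hi => ?_
  simp only [destRx1, shiftMat_mulVec]
  rw [if_neg (by omega), if_neg (by omega)]

/-- Message 1, the signals at relay 1 and the non-interfering part of the signal of source 2
determine the signals at relay 2. -/
lemma relayRxAt2_determined (hmn : m ≤ n) {T : ℕ} (hw : w1 = v1)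
    (hY : ∀ t < T, relayRxAt1 C w1 w2 t = relayRxAt1 C v1 v2 t)
    (hL : ∀ t < T, lowLevels (n - m) (srcXat C w1 w2 t).2 =
      lowLevels (n - m) (srcXat C v1 v2 t).2) :
    ∀ t < T, relayRxAt2 C w1 w2 t = relayRxAt2 C v1 v2 t := by
  intro t
  induction t using Nat.strong_induction_on with
  | _ t ih =>
    intro ht
    have hR1 := relayTxAt1_determined hY
    have hR2 : ∀ u < t, relayTxAt2 C w1 w2 u = relayTxAt2 C v1 v2 u := by
      intro u hu
      rw [relayTxAt2_eq, relayTxAt2_eq]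
      exact congrArg (C.encR2 u) (funext fun s => ih s (by omega) (by omega))
    have hA : ∀ u < t, srcRxAt1 C w1 w2 u = srcRxAt1 C v1 v2 u := by
      intro u hu
      simp only [srcRxAt1, hR1 u (by omega), hR2 u hu]
    have hX1 := srcXat_fst_determined hw hA t le_rfl
    have hV := interf2_determined hX1 (hY t ht)
    have hX2 : (srcXat C w1 w2 t).2 = (srcXat C v1 v2 t).2 := by
      refine eq_of_lowLevels_eq (hL t ht) fun i hi => ?_
      have h := congrFun hV ⟨i + (max m n - m), by omega⟩
      simp only [interf2, shiftMat_mulVec] at h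
      rw [if_pos (by omega), if_pos (by omega)] at h
      simpa using h
    rw [relayRxAt2_eq, relayRxAt2_eq, hX1, hX2]

end Determination

end Signals

end TwoHopIC

/-! ### Converse -/

namespace UniformEntropy

/-- The erasure variable of Fano's inequality and the guess determine the message. -/
lemma eq_of_guess_eq {Ω : Type*} {M : ℕ} {W G : Ω → Fin M} {ω ω' : Ω} (hG : G ω = G ω')
    (hE : (if G ω = W ω then none else some (W ω)) =
      if G ω' = W ω' then none else some (W ω')) : W ω = W ω' := by
  by_cases h : G ω = W ω <;> by_cases h' : G ω' = W ω' <;> simp_all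

variable {Ω α₁ α₂ β₁ β₂ γ₁ γ₂ δ ζ η : Type*} [Fintype Ω] [Nonempty Ω]

/-- The information inequality behind the bound with the backward cross link: `A`, `B` are the
overheard signals of the sources, `V₁`, `V₂` the interferences, `Y₂` the signal of relay 2,
which is determined by its lower part `L₂` and `V₂`, and `E₂` is the erasure variable of
decoder 2. -/
lemma entropy_add_le_of_feedback {W₁ : Ω → α₁} {W₂ : Ω → α₂} {A : Ω → β₁} {B : Ω → β₂}
    {V₁ : Ω → γ₁} {V₂ : Ω → γ₂} {Y₂ : Ω → δ} {L₂ : Ω → ζ} {E₂ : Ω → η}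
    (hW : entropy W₁ + entropy W₂ ≤ entropy fun ω => (W₁ ω, W₂ ω))
    (hV₁ : ∀ ω ω', W₁ ω = W₁ ω' → A ω = A ω' → V₁ ω = V₁ ω')
    (hA : ∀ ω ω', W₂ ω = W₂ ω' → V₁ ω = V₁ ω' → B ω = B ω' → A ω = A ω')
    (hV₁' : ∀ ω ω', W₂ ω = W₂ ω' → B ω = B ω' → Y₂ ω = Y₂ ω' → V₁ ω = V₁ ω')
    (hE : ∀ ω ω', Y₂ ω = Y₂ ω' → E₂ ω = E₂ ω' → W₂ ω = W₂ ω')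
    (hL : ∀ ω ω', V₂ ω = V₂ ω' → L₂ ω = L₂ ω' → Y₂ ω = Y₂ ω') :
    entropy W₂ + entropy (fun ω => (V₁ ω, A ω)) ≤
      entropy A + entropy E₂ + entropy L₂ + entropy (fun ω => (V₂ ω, B ω)) := by
  have s1 : entropy (fun ω => (W₁ ω, W₂ ω)) + entropy (fun ω => (V₁ ω, A ω)) ≤
      entropy (fun ω => (W₁ ω, A ω)) + entropy (fun ω => (V₁ ω, A ω, W₂ ω)) := by
    refine entropy_submodular ?_ ?_ ?_
    · intro ω ω' h h'
      simp only [Prod.mk.injEq] at h h' ⊢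
      exact ⟨h.1, h'.2.2⟩
    · intro ω ω' h
      simp only [Prod.mk.injEq] at h ⊢
      exact ⟨hV₁ _ _ h.1 h.2, h.2⟩
    · intro ω ω' h
      simp only [Prod.mk.injEq] at h ⊢
      exact ⟨h.1, h.2.1⟩
  have s2 := entropy_pair_le W₁ A
  have s3 : entropy (fun ω => (V₁ ω, A ω, W₂ ω)) ≤ entropy (fun ω => (Y₂ ω, B ω, W₂ ω)) := by
    refine entropy_mono fun ω ω' h => ?_
    simp only [Prod.mk.injEq] at h ⊢
    have hv := hV₁' _ _ h.2.2 h.2.1 h.1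
    exact ⟨hv, hA _ _ h.2.2 hv h.2.1, h.2.2⟩
  have s4 : entropy (fun ω => (Y₂ ω, B ω, W₂ ω)) ≤
      entropy (fun ω => (Y₂ ω, B ω)) + entropy E₂ := by
    refine entropy_le_add fun ω ω' h h' => ?_
    simp only [Prod.mk.injEq] at h ⊢
    exact ⟨h.1, h.2, hE _ _ h.1 h'⟩
  have s5 : entropy (fun ω => (Y₂ ω, B ω)) ≤ entropy (fun ω => (V₂ ω, B ω)) + entropy L₂ := by
    refine entropy_le_add fun ω ω' h h' => ?_
    simp only [Prod.mk.injEq] at h ⊢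
    exact ⟨hL _ _ h.1 h', h.2⟩
  linarith

/-- A sequence of `N` binary vectors of length `k` carries at most `N k` bits. -/
lemma entropy_binary_le {N k : ℕ} (X : Ω → Fin N → Fin k → ZMod 2) :
    entropy X ≤ N * k * Real.log 2 := by
  refine (entropy_le_log_card X).trans (le_of_eq ?_)
  simp [ZMod.card, Real.log_pow, mul_assoc]

end UniformEntropy

namespace TwoHopIC

open UniformEntropy

section Converse

variable {n m f nb mb N M1 M2 : ℕ} (C : Code n m f nb mb N M1 M2)

/-- Erasure variable of decoder 1. -/
noncomputable def erasure1 (w : Fin M1 × Fin M2) : Option (Fin M1) :=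
  if C.dec1 (fun t => destRx1 C w.1 w.2 t) = w.1 then none else some w.1

/-- Erasure variable of decoder 2. -/
noncomputable def erasure2 (w : Fin M1 × Fin M2) : Option (Fin M2) :=
  if C.dec2 (fun t => destRx2 C w.1 w.2 t) = w.2 then none else some w.2

variable {C}

lemma fst_determined_of_dest {w v : Fin M1 × Fin M2}
    (hD : ∀ t < N, destRx1 C w.1 w.2 t = destRx1 C v.1 v.2 t)
    (hE : erasure1 C w = erasure1 C v) : w.1 = v.1 :=
  eq_of_guess_eq (W := Prod.fst)
    (G := fun w : Fin M1 × Fin M2 => C.dec1 fun t => destRx1 C w.1 w.2 t)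
    (congrArg C.dec1 (funext fun t => hD t t.isLt)) hE

lemma snd_determined_of_dest {w v : Fin M1 × Fin M2}
    (hD : ∀ t < N, destRx2 C w.1 w.2 t = destRx2 C v.1 v.2 t)
    (hE : erasure2 C w = erasure2 C v) : w.2 = v.2 :=
  eq_of_guess_eq (W := Prod.snd)
    (G := fun w : Fin M1 × Fin M2 => C.dec2 fun t => destRx2 C w.1 w.2 t)
    (congrArg C.dec2 (funext fun t => hD t t.isLt)) hE

lemma fst_determined {w v : Fin M1 × Fin M2}
    (hY : ∀ t < N, relayRxAt1 C w.1 w.2 t = relayRxAt1 C v.1 v.2 t)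
    (hE : erasure1 C w = erasure1 C v) : w.1 = v.1 :=
  fst_determined_of_dest
    (fun t ht => by rw [destRx1, destRx1, relayTxAt1_determined hY t ht.le]) hE

lemma snd_determined {w v : Fin M1 × Fin M2}
    (hY : ∀ t < N, relayRxAt2 C w.1 w.2 t = relayRxAt2 C v.1 v.2 t)
    (hE : erasure2 C w = erasure2 C v) : w.2 = v.2 := by
  refine snd_determined_of_dest (fun t ht => ?_) hE
  have h := relayTxAt1_determined (C := C.swap) (w1 := w.2) (w2 := w.1) (v1 := v.2) (v2 := v.1)
    (T := N) (fun t ht => by simpa only [relayRxAt1_swap] using hY t ht) t ht.le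
  rw [destRx2, destRx2, ← relayTxAt1_swap, ← relayTxAt1_swap, h]

variable (C) [NeZero M1] [NeZero M2] {ε : ℝ}

lemma entropy_erasure_le (h0 : 0 < ε) (h1 : ε < 1) (herr : errProb C ≤ ε) :
    entropy (erasure1 C) ≤ fanoTerm ε M1 ∧ entropy (erasure2 C) ≤ fanoTerm ε M2 := by
  have hpos : (0 : ℝ) < (M1 : ℝ) * M2 := by
    have := Nat.pos_of_neZero M1
    have := Nat.pos_of_neZero M2
    positivity
  rw [errProb, div_le_iff₀ hpos] at herr
  have hcard : ((Fintype.card (Fin M1 × Fin M2) : ℕ) : ℝ) = (M1 : ℝ) * M2 := by simp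
  constructor
  · refine fano Prod.fst _ h0 h1 (le_trans (Nat.cast_le.2 (Finset.card_le_card ?_))
      (herr.trans_eq (by rw [hcard])))
    exact fun w hw => by simp only [Finset.mem_filter] at hw ⊢; exact ⟨hw.1, Or.inl hw.2⟩
  · refine fano Prod.snd _ h0 h1 (le_trans (Nat.cast_le.2 (Finset.card_le_card ?_))
      (herr.trans_eq (by rw [hcard])))
    exact fun w hw => by simp only [Finset.mem_filter] at hw ⊢; exact ⟨hw.1, Or.inr hw.2⟩

/-- Cut-set bound at the destinations. -/
lemma log_card_le_dest (h0 : 0 < ε) (h1 : ε < 1) (herr : errProb C ≤ ε) :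
    Real.log M1 + Real.log M2 ≤
    N * (2 * f) * Real.log 2 + fanoTerm ε M1 + fanoTerm ε M2 := by
  obtain ⟨hE1, hE2⟩ := entropy_erasure_le C h0 h1 herr
  have e1 : entropy (Prod.fst : Fin M1 × Fin M2 → _) = Real.log M1 := by
    rw [entropy_fst, Fintype.card_fin]
  have e2 : entropy (Prod.snd : Fin M1 × Fin M2 → _) = Real.log M2 := by
    rw [entropy_snd, Fintype.card_fin]
  have b1 : entropy (Prod.fst : Fin M1 × Fin M2 → _) ≤
      entropy (fun (w : Fin M1 × Fin M2) (t : Fin N) => lowLevels f (destRx1 C w.1 w.2 t)) +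
        entropy (erasure1 C) :=
    entropy_le_add fun w v h h' => fst_determined_of_dest
      (fun t ht => destRx1_eq_of_lowLevels (congrFun h ⟨t, ht⟩)) h'
  have b2 : entropy (Prod.snd : Fin M1 × Fin M2 → _) ≤
      entropy (fun (w : Fin M1 × Fin M2) (t : Fin N) => lowLevels f (destRx2 C w.1 w.2 t)) +
        entropy (erasure2 C) := by
    refine entropy_le_add fun w v h h' => snd_determined_of_dest (fun t ht => ?_) h'
    rw [← destRx1_swap, ← destRx1_swap]
    apply destRx1_eq_of_lowLevels
    rw [destRx1_swap, destRx1_swap]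
    exact congrFun h ⟨t, ht⟩
  have c1 := entropy_binary_le
    (fun (w : Fin M1 × Fin M2) (t : Fin N) => lowLevels f (destRx1 C w.1 w.2 t))
  have c2 := entropy_binary_le
    (fun (w : Fin M1 × Fin M2) (t : Fin N) => lowLevels f (destRx2 C w.1 w.2 t))
  linarith

/-- The bound that holds for arbitrary feedback from the relays to the sources. -/
lemma log_card_le_relay (h0 : 0 < ε) (h1 : ε < 1) (herr : errProb C ≤ ε)
    (hmn : m ≤ n) : Real.log M1 + Real.log M2 ≤
    N * (2 * n - m) * Real.log 2 + fanoTerm ε M1 + fanoTerm ε M2 := by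
  obtain ⟨hE1, hE2⟩ := entropy_erasure_le C h0 h1 herr
  have hW : Real.log M1 + Real.log M2 =
      entropy (fun w : Fin M1 × Fin M2 => w) := by
    rw [entropy_of_injective (fun _ _ h => h), Fintype.card_prod, Fintype.card_fin,
      Fintype.card_fin, Nat.cast_mul, Real.log_mul] <;> exact NeZero.ne _
  have b1 : entropy (fun w : Fin M1 × Fin M2 => w) ≤
      entropy (fun (w : Fin M1 × Fin M2) => (w.1, fun t : Fin N => relayRxAt1 C w.1 w.2 t,
        fun t : Fin N => relayRxAt2 C w.1 w.2 t)) + entropy (erasure2 C) := by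
    refine entropy_le_add fun w v h h' => ?_
    simp only [Prod.mk.injEq] at h
    exact Prod.ext h.1 (snd_determined (fun t ht => congrFun h.2.2 ⟨t, ht⟩) h')
  have b2 : entropy (fun (w : Fin M1 × Fin M2) => (w.1, fun t : Fin N => relayRxAt1 C w.1 w.2 t,
        fun t : Fin N => relayRxAt2 C w.1 w.2 t)) ≤
      entropy (fun (w : Fin M1 × Fin M2) => (w.1, fun t : Fin N => relayRxAt1 C w.1 w.2 t)) +
      entropy (fun (w : Fin M1 × Fin M2) (t : Fin N) =>
        lowLevels (n - m) (srcXat C w.1 w.2 t).2) := by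
    refine entropy_le_add fun w v h h' => ?_
    simp only [Prod.mk.injEq] at h ⊢
    exact ⟨h.1, h.2, funext fun t => relayRxAt2_determined hmn h.1
      (fun t ht => congrFun h.2 ⟨t, ht⟩) (fun t ht => congrFun h' ⟨t, ht⟩) t t.isLt⟩
  have b3 : entropy (fun (w : Fin M1 × Fin M2) =>
        (w.1, fun t : Fin N => relayRxAt1 C w.1 w.2 t)) ≤
      entropy (fun (w : Fin M1 × Fin M2) (t : Fin N) => relayRxAt1 C w.1 w.2 t) +
      entropy (erasure1 C) := by
    refine entropy_le_add fun w v h h' => ?_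
    exact Prod.ext (fst_determined (fun t ht => congrFun h ⟨t, ht⟩) h') h
  have c1 := entropy_binary_le
    (fun (w : Fin M1 × Fin M2) (t : Fin N) => relayRxAt1 C w.1 w.2 t)
  have c2 := entropy_binary_le
    (fun (w : Fin M1 × Fin M2) (t : Fin N) => lowLevels (n - m) (srcXat C w.1 w.2 t).2)
  have hmax : ((max m n : ℕ) : ℝ) = n := by rw [max_eq_right hmn]
  rw [hmax] at c1
  rw [Nat.cast_sub hmn] at c2
  linarith

lemma log_card_prod :
    Real.log (Fintype.card (Fin M1 × Fin M2)) = Real.log M1 + Real.log M2 := by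
  rw [Fintype.card_prod, Fintype.card_fin, Fintype.card_fin, Nat.cast_mul, Real.log_mul] <;>
    exact NeZero.ne _

/-- Entropy bound on message 2 by the feedback to source 1. -/
lemma entropy_snd_le_feedback (hmn : m ≤ n) (h2 : nb ≤ mb) :
    Real.log M2 + entropy (fun w : Fin M1 × Fin M2 => (fun t : Fin N => interf1 C w.1 w.2 t,
        fun t : Fin N => srcRxAt1 C w.1 w.2 t)) ≤
      entropy (fun (w : Fin M1 × Fin M2) (t : Fin N) => srcRxAt1 C w.1 w.2 t) +
      entropy (erasure2 C) +
      entropy (fun (w : Fin M1 × Fin M2) (t : Fin N) =>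
        lowLevels (max (n - m) m) (relayRxAt2 C w.1 w.2 t)) +
      entropy (fun w : Fin M1 × Fin M2 => (fun t : Fin N => interf2 C w.1 w.2 t,
        fun t : Fin N => srcRxAt2 C w.1 w.2 t)) := by
  have e1 : entropy (Prod.fst : Fin M1 × Fin M2 → _) = Real.log M1 := by
    rw [entropy_fst, Fintype.card_fin]
  have e2 : entropy (Prod.snd : Fin M1 × Fin M2 → _) = Real.log M2 := by
    rw [entropy_snd, Fintype.card_fin]
  rw [← e2]
  refine entropy_add_le_of_feedback (W₁ := Prod.fst)
    (Y₂ := fun w (t : Fin N) => relayRxAt2 C w.1 w.2 t) ?_ ?_ ?_ ?_ ?_ ?_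
  · rw [e1, e2, ← log_card_prod,
      entropy_of_injective (X := fun w : Fin M1 × Fin M2 => (w.1, w.2)) fun _ _ h => h]
  · intro w v h hA
    funext t
    rw [interf1, interf1, srcXat_fst_determined h (fun s hs => congrFun hA ⟨s, hs⟩) t t.isLt.le]
  · intro w v h hV hB
    funext t
    exact srcRxAt1_determined h2 h (fun s hs => congrFun hV ⟨s, hs⟩)
      (fun s hs => congrFun hB ⟨s, hs⟩) t t.isLt
  · intro w v h hB hY
    funext t
    exact interf1_determined
      (srcXat_snd_determined h (fun s hs => congrFun hB ⟨s, hs⟩) t t.isLt.le) (congrFun hY t)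
  · exact fun w v hY hE => snd_determined (fun s hs => congrFun hY ⟨s, hs⟩) hE
  · intro w v hV hL
    funext t
    exact relayRxAt2_determined_of_interf hmn (congrFun hV t) (congrFun hL t)

/-- Entropy bound on message 1 by the feedback to source 2. -/
lemma entropy_fst_le_feedback (hmn : m ≤ n) (h2 : nb ≤ mb) :
    Real.log M1 + entropy (fun w : Fin M1 × Fin M2 => (fun t : Fin N => interf2 C w.1 w.2 t,
        fun t : Fin N => srcRxAt2 C w.1 w.2 t)) ≤
      entropy (fun (w : Fin M1 × Fin M2) (t : Fin N) => srcRxAt2 C w.1 w.2 t) +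
      entropy (erasure1 C) +
      entropy (fun (w : Fin M1 × Fin M2) (t : Fin N) =>
        lowLevels (max (n - m) m) (relayRxAt1 C w.1 w.2 t)) +
      entropy (fun w : Fin M1 × Fin M2 => (fun t : Fin N => interf1 C w.1 w.2 t,
        fun t : Fin N => srcRxAt1 C w.1 w.2 t)) := by
  have e1 : entropy (Prod.fst : Fin M1 × Fin M2 → _) = Real.log M1 := by
    rw [entropy_fst, Fintype.card_fin]
  have e2 : entropy (Prod.snd : Fin M1 × Fin M2 → _) = Real.log M2 := by
    rw [entropy_snd, Fintype.card_fin]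
  rw [← e1]
  refine entropy_add_le_of_feedback (W₁ := Prod.snd)
    (Y₂ := fun w (t : Fin N) => relayRxAt1 C w.1 w.2 t) ?_ ?_ ?_ ?_ ?_ ?_
  · rw [e1, e2, add_comm, ← log_card_prod,
      entropy_of_injective (X := fun w : Fin M1 × Fin M2 => (w.2, w.1)) Prod.swap_injective]
  · intro w v h hA
    funext t
    rw [interf2, interf2, srcXat_snd_determined h (fun s hs => congrFun hA ⟨s, hs⟩) t t.isLt.le]
  · intro w v h hV hB
    funext t
    exact srcRxAt2_determined h2 h (fun s hs => congrFun hV ⟨s, hs⟩)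
      (fun s hs => congrFun hB ⟨s, hs⟩) t t.isLt
  · intro w v h hB hY
    funext t
    exact interf2_determined
      (srcXat_fst_determined h (fun s hs => congrFun hB ⟨s, hs⟩) t t.isLt.le) (congrFun hY t)
  · exact fun w v hY hE => fst_determined (fun s hs => congrFun hY ⟨s, hs⟩) hE
  · intro w v hV hL
    funext t
    exact relayRxAt1_determined hmn (congrFun hV t) (congrFun hL t)

lemma entropy_srcRxAt_le (h2 : nb ≤ mb) :
    entropy (fun (w : Fin M1 × Fin M2) (t : Fin N) => srcRxAt1 C w.1 w.2 t) ≤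
      N * mb * Real.log 2 ∧
    entropy (fun (w : Fin M1 × Fin M2) (t : Fin N) => srcRxAt2 C w.1 w.2 t) ≤
      N * mb * Real.log 2 := by
  constructor
  · refine (entropy_mono fun w v h => ?_).trans
      (entropy_binary_le fun w t => lowLevels mb (srcRxAt1 C w.1 w.2 t))
    funext t
    exact srcRxAt1_eq_of_lowLevels h2 (congrFun h t)
  · simp only [← srcRxAt1_swap]
    refine (entropy_mono fun w v h => ?_).trans
      (entropy_binary_le fun w t => lowLevels mb (srcRxAt1 C.swap w.2 w.1 t))
    funext t
    exact srcRxAt1_eq_of_lowLevels h2 (congrFun h t)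

/-- The bound by the capacity of the backward cross links. -/
lemma log_card_le_feedback (h0 : 0 < ε) (h1 : ε < 1) (herr : errProb C ≤ ε)
    (hmn : m ≤ n) (h2 : nb ≤ mb) : Real.log M1 + Real.log M2 ≤
    N * (2 * max ((n : ℝ) - m) m + 2 * mb) * Real.log 2 + fanoTerm ε M1 + fanoTerm ε M2 := by
  obtain ⟨hE1, hE2⟩ := entropy_erasure_le C h0 h1 herr
  obtain ⟨d1, d2⟩ := entropy_srcRxAt_le C h2
  have b1 := entropy_fst_le_feedback C hmn h2
  have b2 := entropy_snd_le_feedback C hmn h2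
  have c1 := entropy_binary_le (fun (w : Fin M1 × Fin M2) (t : Fin N) =>
    lowLevels (max (n - m) m) (relayRxAt1 C w.1 w.2 t))
  have c2 := entropy_binary_le (fun (w : Fin M1 × Fin M2) (t : Fin N) =>
    lowLevels (max (n - m) m) (relayRxAt2 C w.1 w.2 t))
  have hmax : ((max (n - m) m : ℕ) : ℝ) = max ((n : ℝ) - m) m := by
    rw [Nat.cast_max, Nat.cast_sub hmn]
  rw [hmax] at c1 c2
  linarith

/-- Bounds on the sizes of the message sets that are linear in the blocklength up to the terms of
Fano's inequality bound the achievable rates. -/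
lemma Achievable.add_le {R1 R2 T : ℝ} (h : Achievable n m f nb mb R1 R2)
    (hT : ∀ (N M1 M2 : ℕ) (C : Code n m f nb mb N M1 M2) (ε : ℝ), 0 < M1 → 0 < M2 → 0 < ε →
      ε < 1 → errProb C ≤ ε →
      Real.log M1 + Real.log M2 ≤ N * T * Real.log 2 + fanoTerm ε M1 + fanoTerm ε M2) :
    R1 + R2 ≤ T := by
  obtain ⟨-, -, h⟩ := h
  have hlog2 : 0 < Real.log 2 := Real.log_pos (by norm_num)
  set g : ℝ → ℝ := fun ε => -Real.log (1 - ε) - ε * Real.log ε with hg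
  have key : ∀ ε, 0 < ε → ε < 1 → 0 ≤ g ε →
      (1 - ε) * (R1 + R2) * Real.log 2 ≤ T * Real.log 2 + 2 * g ε := by
    intro ε h0 h1 hgε
    obtain ⟨N, hN, C, herr⟩ := h ε h0
    have hbase : ∀ R : ℝ, (0 : ℝ) < 2 ^ ((N : ℝ) * R) := fun R => by positivity
    have hpos : ∀ R : ℝ, 0 < ⌈(2 : ℝ) ^ ((N : ℝ) * R)⌉₊ := fun R => Nat.ceil_pos.2 (hbase R)
    have hlog : ∀ R : ℝ, N * R * Real.log 2 ≤ Real.log ⌈(2 : ℝ) ^ ((N : ℝ) * R)⌉₊ := fun R => by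
      rw [← Real.log_rpow (by norm_num)]
      exact Real.log_le_log (hbase R) (Nat.le_ceil _)
    have hb := hT N _ _ C ε (hpos R1) (hpos R2) h0 h1 herr
    simp only [fanoTerm] at hb
    have h3 := mul_le_mul_of_nonneg_left (add_le_add (hlog R1) (hlog R2)) (sub_nonneg.2 h1.le)
    have hN' : (1 : ℝ) ≤ N := by exact_mod_cast hN
    have hN0 : (0 : ℝ) < N := by linarith
    have h4 : N * ((1 - ε) * (R1 + R2) * Real.log 2) ≤ N * (T * Real.log 2) + 2 * g ε := by
      simp only [hg]
      linarith
    have h5 : N * ((1 - ε) * (R1 + R2) * Real.log 2) ≤ N * (T * Real.log 2 + 2 * g ε) := by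
      nlinarith
    exact le_of_mul_le_mul_left h5 hN0
  have hcont : ContinuousAt g 0 := by
    have h1 : ContinuousAt (fun ε : ℝ => Real.log (1 - ε)) 0 :=
      ContinuousAt.log (by fun_prop) (by norm_num)
    exact h1.neg.sub Real.continuous_mul_log.continuousAt
  have hleft : Filter.Tendsto (fun ε => (1 - ε) * (R1 + R2) * Real.log 2) (nhdsWithin 0 (Set.Ioi 0))
      (nhds ((1 - 0) * (R1 + R2) * Real.log 2)) :=
    (Continuous.tendsto (by fun_prop) 0).mono_left nhdsWithin_le_nhds
  have hright : Filter.Tendsto (fun ε => T * Real.log 2 + 2 * g ε) (nhdsWithin 0 (Set.Ioi 0))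
      (nhds (T * Real.log 2 + 2 * g 0)) :=
    (tendsto_const_nhds.add (hcont.tendsto.const_mul 2)).mono_left nhdsWithin_le_nhds
  have hlim := le_of_tendsto_of_tendsto hleft hright (by
    filter_upwards [Ioo_mem_nhdsGT (zero_lt_one' ℝ)] with ε hε
    have hl1 : Real.log (1 - ε) ≤ 0 :=
      Real.log_nonpos (by linarith [hε.2]) (by linarith [hε.1])
    have hl2 : ε * Real.log ε ≤ 0 :=
      mul_nonpos_of_nonneg_of_nonpos hε.1.le (Real.log_nonpos hε.1.le hε.2.le)
    exact key ε hε.1 hε.2 (by simp only [hg]; linarith))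
  simp only [hg, sub_zero, one_mul, Real.log_one, neg_zero, zero_mul, mul_zero, add_zero] at hlim
  exact le_of_mul_le_mul_right hlim hlog2

lemma Achievable.add_le_capacity {R1 R2 : ℝ} (h : Achievable n m f nb mb R1 R2) (hmn : m ≤ n)
    (h2 : nb ≤ mb) : R1 + R2 ≤
      min (2 * max ((n : ℝ) - m) m + 2 * mb) (min (2 * (n : ℝ) - m) (2 * f)) := by
  refine le_min (h.add_le ?_) (le_min (h.add_le ?_) (h.add_le ?_)) <;>
    intro N M1 M2 C ε hM1 hM2 h0 h1 herr <;> have := NeZero.of_pos hM1 <;>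
    have := NeZero.of_pos hM2
  · exact log_card_le_feedback C h0 h1 herr hmn h2
  · exact log_card_le_relay C h0 h1 herr hmn
  · exact log_card_le_dest C h0 h1 herr

end Converse

end TwoHopIC

/-! ### Achievability

Each source splits its `n` levels as follows, with `c = 2 * m - n` (truncated): the levels `[0, c)` and
`[m, n)` carry fresh bits that do not disturb decoding at the other relay, the levels `[c, c + kh)`
repeat bits of the other user that were overheard two slots after they were sent, and the levels
`[c + kh, c + kh + kf)` carry fresh bits that are overheard by the other source. A data stream
`D : ℕ → ℕ → ZMod 2` assigns a bit to each time slot and index; its first `kf` indices are the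
overheard ones. -/

namespace TwoHopIC

section Scheme

/-- Level `i` of a source with fresh bits `D` and repeated bits `H`. -/
def schemeSrc (m c kh kf : ℕ) (D H : ℕ → ZMod 2) (i : ℕ) : ZMod 2 :=
  if i < c then D (kf + i)
  else if i < c + kh then H (i - c)
  else if i < c + kh + kf then D (i - c - kh)
  else if m ≤ i then D (kf + c + (i - m))
  else 0

/-- Level `i` of the signal at a relay at time `u`, if the streams of its own source and of the
other source are `D` and `D'`. -/
def schemeRelayRx (n m c kh kf : ℕ) (D D' : ℕ → ℕ → ZMod 2) (u i : ℕ) : ZMod 2 :=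
  schemeSrc m c kh kf (D u) (D' (u - 2)) i +
    if n - m ≤ i then schemeSrc m c kf kh (D' u) (D (u - 2)) (i - (n - m)) else 0

/-- Level `j` of the signal sent by a relay at time `t`. -/
def schemeRelayTx (kf : ℕ) (D : ℕ → ℕ → ZMod 2) (t j : ℕ) : ZMod 2 :=
  if j < kf then D (t - 1) j else D (t - 3) j

/-- The interference on level `i` at time `u`, reconstructed by a relay that received `y`. -/
def interfEstimate (n m c kh kf : ℕ) (y : ℕ → ℕ → ZMod 2) (u i : ℕ) : ZMod 2 :=
  if i < n - m then 0
  else if i - (n - m) < c + kf then y (u - 2) (kh + (i - (n - m)))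
  else if i - (n - m) < c + kf + kh then y (u + 2) (i - (n - m) - kf)
  else 0

/-- The map by which a relay computes level `j` of its signal at time `t` from its past received
signals `y`. -/
def relayMap (n m c kh kf : ℕ) (y : ℕ → ℕ → ZMod 2) (t j : ℕ) : ZMod 2 :=
  if j < kf then (if t = 0 then 0 else y (t - 1) (c + kh + j))
  else if t < 3 then 0
  else if j < kf + c then y (t - 3) (j - kf)
  else if j < kf + c + (n - m) then
    y (t - 3) (m + (j - kf - c)) - interfEstimate n m c kh kf y (t - 3) (m + (j - kf - c))
  else 0

lemma interfEstimate_eq {n m c kh kf : ℕ} (hmn : m ≤ n) (hc : c = 2 * m - n)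
    (hk : c + kh + kf ≤ m) (hk' : c + kh + kf ≤ n - m) {D D' y : ℕ → ℕ → ZMod 2} {t : ℕ}
    (hy : ∀ u < t, ∀ i < n, y u i = schemeRelayRx n m c kh kf D D' u i) {u i : ℕ} (hu : u + 2 < t)
    (hmi : m ≤ i) (hin : i < n) :
    interfEstimate n m c kh kf y u i =
      if n - m ≤ i then schemeSrc m c kf kh (D' u) (D (u - 2)) (i - (n - m)) else 0 := by
  unfold interfEstimate
  split_ifs with h1 h2 h3 h4 h5 h6
  · omega
  · rfl
  · rw [hy _ (by omega) _ (by omega), schemeRelayRx, if_neg (by omega), add_zero, schemeSrc,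
      schemeSrc, if_neg (by omega), if_neg (by omega), if_pos (by omega), if_neg (by omega),
      if_pos (by omega)]
    congr 1
    omega
  · omega
  · rw [hy _ (by omega) _ (by omega), schemeRelayRx, if_neg (by omega), add_zero, schemeSrc,
      schemeSrc, if_neg (by omega), if_pos (by omega), if_neg (by omega), if_neg (by omega),
      if_pos (by omega)]
    congr 1
    omega
  · omega
  · rw [schemeSrc, if_neg (by omega), if_neg (by omega), if_neg (by omega), if_neg (by omega)]
  · omega

lemma relayMap_eq {n m c kh kf : ℕ} (hmn : m ≤ n) (hc : c = 2 * m - n)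
    (hk : c + kh + kf ≤ m) (hk' : c + kh + kf ≤ n - m) {D D' y : ℕ → ℕ → ZMod 2}
    (hD : D 0 = 0) (hsupp : ∀ t j, kf + c + (n - m) ≤ j → D t j = 0) {t : ℕ}
    (hy : ∀ u < t, ∀ i < n, y u i = schemeRelayRx n m c kh kf D D' u i) (j : ℕ) :
    relayMap n m c kh kf y t j = schemeRelayTx kf D t j := by
  unfold relayMap schemeRelayTx
  split_ifs with h1 h2 h3 h4 h5
  · simp [h2, hD]
  · rw [hy _ (by omega) _ (by omega), schemeRelayRx, if_neg (by omega), add_zero, schemeSrc,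
      if_neg (by omega), if_neg (by omega), if_pos (by omega)]
    congr 1
    omega
  · rw [show t - 3 = 0 by omega, hD]
    rfl
  · rw [hy _ (by omega) _ (by omega), schemeRelayRx, if_neg (by omega), add_zero, schemeSrc,
      if_pos (by omega)]
    congr 1
    omega
  · rw [interfEstimate_eq hmn hc hk hk' hy (by omega) (by omega) (by omega),
      hy _ (by omega) _ (by omega), schemeRelayRx, add_sub_cancel_right, schemeSrc,
      if_neg (by omega), if_neg (by omega), if_neg (by omega), if_pos (by omega)]
    congr 1
    omega
  · exact (hsupp _ _ (by omega)).symm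

/-- Extension of a finite family of vectors by zero. -/
def extendZero {t q : ℕ} (ys : Fin t → Fin q → ZMod 2) (u i : ℕ) : ZMod 2 :=
  if h : u < t ∧ i < q then ys ⟨u, h.1⟩ ⟨i, h.2⟩ else 0

/-- The bits of the other user that a source with stream `D` extracts at time `t` from its past
overheard signals `z`. -/
def overheardBits (nb mb qb kf : ℕ) (D z : ℕ → ℕ → ZMod 2) (t j : ℕ) : ZMod 2 :=
  if t = 0 then 0
  else z (t - 1) (qb - mb + j) -
    if mb - nb ≤ j then schemeRelayTx kf D (t - 1) (j - (mb - nb)) else 0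

variable {n m f nb mb N M1 M2 : ℕ}

/-- The code with data streams `D1`, `D2` and decoders `g1`, `g2`. -/
def schemeCode (n m f nb mb c k1 k2 : ℕ) (D1 : Fin M1 → ℕ → ℕ → ZMod 2)
    (D2 : Fin M2 → ℕ → ℕ → ZMod 2) (g1 : (Fin N → BSig f nb mb) → Fin M1)
    (g2 : (Fin N → BSig f nb mb) → Fin M2) : Code n m f nb mb N M1 M2 where
  encS1 t w z i := schemeSrc m c k1 k2 (D1 w t)
    (overheardBits nb mb (max mb (max nb f)) k2 (D1 w) (extendZero z) t) i
  encS2 t w z i := schemeSrc m c k2 k1 (D2 w t)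
    (overheardBits nb mb (max mb (max nb f)) k1 (D2 w) (extendZero z) t) i
  encR1 t y j := relayMap n m c k1 k2 (extendZero y) t j
  encR2 t y j := relayMap n m c k2 k1 (extendZero y) t j
  dec1 := g1
  dec2 := g2

lemma schemeSrc_congr {m c kh kf : ℕ} {D H H' : ℕ → ZMod 2} (h : ∀ j < kh, H j = H' j) (i : ℕ) :
    schemeSrc m c kh kf D H i = schemeSrc m c kh kf D H' i := by
  unfold schemeSrc
  split_ifs with h1 h2 h3 h4
  · rfl
  · exact h _ (by omega)
  all_goals rfl

/-- A source that overhears the relay signals of the scheme extracts the right bits. -/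
lemma overheardBits_eq {kh kf : ℕ} (h2 : nb ≤ mb) (hkh : kh ≤ mb) {D D' : ℕ → ℕ → ZMod 2}
    (hD' : D' 0 = 0) {t : ℕ} {x x' : ℕ → BSig f nb mb}
    (hx : ∀ u < t, ∀ j, x u j = schemeRelayTx kf D u j)
    (hx' : ∀ u < t, ∀ j, x' u j = schemeRelayTx kh D' u j) (z : Fin t → BSig f nb mb)
    (hz : ∀ u : Fin t, z u =
      (shiftMat (max mb (max nb f)) (max mb (max nb f) - nb)).mulVec (x u) +
      (shiftMat (max mb (max nb f)) (max mb (max nb f) - mb)).mulVec (x' u)) :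
    ∀ j < kh, overheardBits nb mb (max mb (max nb f)) kf D (extendZero z) t j = D' (t - 2) j := by
  intro j hj
  unfold overheardBits
  split_ifs with h0 h1
  · simp [h0, hD']
  · have hlt : t - 1 < t ∧ max mb (max nb f) - mb + j < max mb (max nb f) := by omega
    rw [extendZero, dif_pos hlt, hz]
    simp only [Pi.add_apply, shiftMat_mulVec]
    rw [if_pos (by omega), if_pos (by omega), hx _ hlt.1, hx' _ hlt.1]
    have e1 : max mb (max nb f) - mb + j - (max mb (max nb f) - nb) = j - (mb - nb) := by omega
    have e2 : max mb (max nb f) - mb + j - (max mb (max nb f) - mb) = j := by omega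
    simp only [e1, e2]
    rw [add_sub_cancel_left, schemeRelayTx, if_pos hj, Nat.sub_sub]
  · have hlt : t - 1 < t ∧ max mb (max nb f) - mb + j < max mb (max nb f) := by omega
    rw [extendZero, dif_pos hlt, hz]
    simp only [Pi.add_apply, shiftMat_mulVec]
    rw [if_neg (by omega), if_pos (by omega), hx' _ hlt.1]
    have e2 : max mb (max nb f) - mb + j - (max mb (max nb f) - mb) = j := by omega
    simp only [e2]
    rw [zero_add, sub_zero, schemeRelayTx, if_pos hj, Nat.sub_sub]

/-- Superposition of two source signals at a relay. -/
lemma relay_superposition_eq {c kh kf : ℕ} (hmn : m ≤ n) {D D' : ℕ → ℕ → ZMod 2} {u : ℕ}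
    {x x' : FSig n m} (hx : ∀ i, x i = schemeSrc m c kh kf (D u) (D' (u - 2)) i)
    (hx' : ∀ i, x' i = schemeSrc m c kf kh (D' u) (D (u - 2)) i) (i : Fin (max m n)) :
    ((shiftMat (max m n) (max m n - n)).mulVec x + (shiftMat (max m n) (max m n - m)).mulVec x') i =
      schemeRelayRx n m c kh kf D D' u i := by
  have hq : max m n = n := max_eq_right hmn
  simp only [Pi.add_apply, shiftMat_mulVec, schemeRelayRx, hx, hx', hq, Nat.sub_self, Nat.sub_zero,
    zero_le, if_true]

variable {c k1 k2 : ℕ} {D1 : Fin M1 → ℕ → ℕ → ZMod 2} {D2 : Fin M2 → ℕ → ℕ → ZMod 2}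
  {g1 : (Fin N → BSig f nb mb) → Fin M1} {g2 : (Fin N → BSig f nb mb) → Fin M2}

lemma schemeCode_swap : (schemeCode n m f nb mb c k1 k2 D1 D2 g1 g2).swap =
    schemeCode n m f nb mb c k2 k1 D2 D1 g2 g1 := rfl

/-- If the sources have followed the scheme so far, then so does relay 1. -/
lemma schemeCode_relayTxAt1 (hmn : m ≤ n) (hc : c = 2 * m - n) (hk : c + k1 + k2 ≤ m)
    (hk' : c + k1 + k2 ≤ n - m) {w1 : Fin M1} {w2 : Fin M2} (hD1 : D1 w1 0 = 0)
    (hs1 : ∀ t j, k2 + c + (n - m) ≤ j → D1 w1 t j = 0) {t : ℕ}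
    (hX : ∀ u < t, ∀ i,
      (srcXat (schemeCode n m f nb mb c k1 k2 D1 D2 g1 g2) w1 w2 u).1 i =
        schemeSrc m c k1 k2 (D1 w1 u) (D2 w2 (u - 2)) i ∧
      (srcXat (schemeCode n m f nb mb c k1 k2 D1 D2 g1 g2) w1 w2 u).2 i =
        schemeSrc m c k2 k1 (D2 w2 u) (D1 w1 (u - 2)) i) (j : Fin (max mb (max nb f))) :
    relayTxAt1 (schemeCode n m f nb mb c k1 k2 D1 D2 g1 g2) w1 w2 t j =
      schemeRelayTx k2 (D1 w1) t j := by
  rw [relayTxAt1_eq]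
  refine relayMap_eq (D' := D2 w2) hmn hc hk hk' hD1 hs1 (fun u hu i hi => ?_) j
  rw [extendZero, dif_pos ⟨hu, lt_of_lt_of_le hi (le_max_right _ _)⟩, relayRxAt1_eq]
  exact relay_superposition_eq hmn (fun i => (hX u hu i).1) (fun i => (hX u hu i).2) _

/-- The sources follow the scheme. -/
lemma schemeCode_srcXat (hmn : m ≤ n) (h2 : nb ≤ mb) (hc : c = 2 * m - n) (hk : c + k1 + k2 ≤ m)
    (hk' : c + k1 + k2 ≤ n - m) (hk1 : k1 ≤ mb) (hk2 : k2 ≤ mb) {w1 : Fin M1} {w2 : Fin M2}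
    (hD1 : D1 w1 0 = 0) (hD2 : D2 w2 0 = 0)
    (hs1 : ∀ t j, k2 + c + (n - m) ≤ j → D1 w1 t j = 0)
    (hs2 : ∀ t j, k1 + c + (n - m) ≤ j → D2 w2 t j = 0) (t : ℕ) (i : Fin (max m n)) :
    (srcXat (schemeCode n m f nb mb c k1 k2 D1 D2 g1 g2) w1 w2 t).1 i =
      schemeSrc m c k1 k2 (D1 w1 t) (D2 w2 (t - 2)) i ∧
    (srcXat (schemeCode n m f nb mb c k1 k2 D1 D2 g1 g2) w1 w2 t).2 i =
      schemeSrc m c k2 k1 (D2 w2 t) (D1 w1 (t - 2)) i := by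
  induction t using Nat.strong_induction_on generalizing i with
  | _ t ih =>
    have hR1 : ∀ u < t, ∀ j, relayTxAt1 (schemeCode n m f nb mb c k1 k2 D1 D2 g1 g2) w1 w2 u j =
        schemeRelayTx k2 (D1 w1) u j := fun u hu =>
      schemeCode_relayTxAt1 hmn hc hk hk' hD1 hs1 fun v hv => ih v (hv.trans hu)
    have hR2 : ∀ u < t, ∀ j, relayTxAt2 (schemeCode n m f nb mb c k1 k2 D1 D2 g1 g2) w1 w2 u j =
        schemeRelayTx k1 (D2 w2) u j := by
      intro u hu j
      rw [← relayTxAt1_swap, schemeCode_swap]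
      refine schemeCode_relayTxAt1 hmn hc (by omega) (by omega) hD2 hs2 (fun v hv i => ?_) j
      rw [← schemeCode_swap, srcXat_swap]
      exact (ih v (hv.trans hu) i).symm
    rw [srcXat_fst, srcXat_snd]
    exact ⟨schemeSrc_congr (overheardBits_eq h2 hk1 hD2 hR1 hR2 _ fun _ => rfl) i,
      schemeSrc_congr (overheardBits_eq h2 hk2 hD1 hR2 hR1 _ fun _ => rfl) i⟩

end Scheme

end TwoHopIC

namespace TwoHopIC

section Transmission

/-- The data stream carrying a message of `L` blocks of `r` bits in the time slots `1, …, L`. -/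
def blockStream {L r : ℕ} (b : Fin L → Fin r → ZMod 2) (t j : ℕ) : ZMod 2 :=
  if h : 0 < t ∧ t - 1 < L ∧ j < r then b ⟨t - 1, h.2.1⟩ ⟨j, h.2.2⟩ else 0

lemma blockStream_zero {L r : ℕ} (b : Fin L → Fin r → ZMod 2) : blockStream b 0 = 0 := by
  funext j
  simp [blockStream]

lemma blockStream_of_le {L r : ℕ} (b : Fin L → Fin r → ZMod 2) (t : ℕ) {j : ℕ} (hj : r ≤ j) :
    blockStream b t j = 0 :=
  dif_neg (by omega)

lemma blockStream_succ {L r : ℕ} (b : Fin L → Fin r → ZMod 2) (s : Fin L) (j : Fin r) :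
    blockStream b (s + 1) j = b s j := by
  simp [blockStream]

/-- The signal at a destination whose relay forwards the stream `D`. -/
def schemeDest (f nb mb kf : ℕ) (D : ℕ → ℕ → ZMod 2) (t : ℕ) : BSig f nb mb :=
  (shiftMat (max mb (max nb f)) (max mb (max nb f) - f)).mulVec fun j => schemeRelayTx kf D t j

lemma schemeDest_apply {f nb mb kf : ℕ} (D : ℕ → ℕ → ZMod 2) (t : ℕ) {j : ℕ} (hj : j < f) :
    schemeDest f nb mb kf D t ⟨max mb (max nb f) - f + j, by omega⟩ = schemeRelayTx kf D t j := by
  rw [schemeDest, shiftMat_mulVec, if_pos (Nat.le_add_right _ _)]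
  simp only [Nat.add_sub_cancel_left]

/-- All blocks reach the destination within `L + 4` time slots. -/
lemma schemeDest_blockStream_injective {f nb mb kf L r : ℕ} (hr : r ≤ f) :
    Function.Injective fun (b : Fin L → Fin r → ZMod 2) (t : Fin (L + 4)) =>
      schemeDest f nb mb kf (blockStream b) t := by
  intro b b' h
  have key : ∀ t < L + 4, ∀ j < f,
      schemeRelayTx kf (blockStream b) t j = schemeRelayTx kf (blockStream b') t j := by
    intro t ht j hj
    rw [← schemeDest_apply (nb := nb) (mb := mb) _ t hj,
      ← schemeDest_apply (nb := nb) (mb := mb) _ t hj]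
    exact congrFun (congrFun h ⟨t, ht⟩) _
  funext s j
  rw [← blockStream_succ b, ← blockStream_succ b']
  by_cases hj : (j : ℕ) < kf
  · simpa [schemeRelayTx, hj] using key (s + 2) (by omega) j (by omega)
  · simpa [schemeRelayTx, hj] using key (s + 4) (by omega) j (by omega)

variable {n m f nb mb c k1 k2 : ℕ}

/-- The scheme transmits `L` blocks per user without error. -/
lemma exists_code_errProb_eq_zero (hmn : m ≤ n) (h2 : nb ≤ mb) (hc : c = 2 * m - n)
    (hk : c + k1 + k2 ≤ m) (hk' : c + k1 + k2 ≤ n - m) (hk1 : k1 ≤ mb) (hk2 : k2 ≤ mb)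
    {r1 r2 : ℕ} (hr1 : r1 ≤ k2 + c + (n - m)) (hr2 : r2 ≤ k1 + c + (n - m)) (hf1 : r1 ≤ f)
    (hf2 : r2 ≤ f) (L : ℕ) :
    ∃ C : Code n m f nb mb (L + 4) (2 ^ (L * r1)) (2 ^ (L * r2)), errProb C = 0 := by
  have hcard : ∀ r, Fintype.card (Fin (2 ^ (L * r))) =
      Fintype.card (Fin L → Fin r → ZMod 2) := fun r => by
    simp [ZMod.card, ← pow_mul, mul_comm]
  let e1 := Fintype.equivOfCardEq (hcard r1)
  let e2 := Fintype.equivOfCardEq (hcard r2)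
  let S1 := fun (w : Fin (2 ^ (L * r1))) (t : Fin (L + 4)) =>
    schemeDest f nb mb k2 (blockStream (e1 w)) t
  let S2 := fun (w : Fin (2 ^ (L * r2))) (t : Fin (L + 4)) =>
    schemeDest f nb mb k1 (blockStream (e2 w)) t
  have hS1 : Function.Injective S1 := (schemeDest_blockStream_injective hf1).comp e1.injective
  have hS2 : Function.Injective S2 := (schemeDest_blockStream_injective hf2).comp e2.injective
  let C := schemeCode n m f nb mb c k1 k2 (fun w => blockStream (e1 w))
    (fun w => blockStream (e2 w)) (Function.invFun S1) (Function.invFun S2)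
  have hX := fun w1 w2 => schemeCode_srcXat (f := f) (g1 := Function.invFun S1)
    (g2 := Function.invFun S2) (w1 := w1) (w2 := w2) (D1 := fun w => blockStream (e1 w))
    (D2 := fun w => blockStream (e2 w)) hmn h2 hc hk hk' hk1 hk2 (blockStream_zero _)
    (blockStream_zero _) (fun t j hj => blockStream_of_le _ t (hr1.trans hj))
    (fun t j hj => blockStream_of_le _ t (hr2.trans hj))
  have hd1 : ∀ w1 w2, (fun t : Fin (L + 4) => destRx1 C w1 w2 t) = S1 w1 := by
    intro w1 w2
    funext t
    refine congrArg _ (funext fun j => ?_)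
    exact schemeCode_relayTxAt1 hmn hc hk hk' (blockStream_zero _)
      (fun t j hj => blockStream_of_le _ t (hr1.trans hj)) (fun u _ => hX w1 w2 u) j
  have hd2 : ∀ w1 w2, (fun t : Fin (L + 4) => destRx2 C w1 w2 t) = S2 w2 := by
    intro w1 w2
    funext t
    refine congrArg _ (funext fun j => ?_)
    rw [← relayTxAt1_swap, schemeCode_swap]
    refine schemeCode_relayTxAt1 hmn hc (by omega) (by omega) (blockStream_zero _)
      (fun t j hj => blockStream_of_le _ t (hr2.trans hj)) (fun u _ i => ?_) j
    rw [← schemeCode_swap, srcXat_swap]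
    exact (hX w1 w2 u i).symm
  refine ⟨C, ?_⟩
  have hempty : (Finset.univ.filter fun w : Fin (2 ^ (L * r1)) × Fin (2 ^ (L * r2)) =>
      C.dec1 (fun t => destRx1 C w.1 w.2 t.val) ≠ w.1 ∨
      C.dec2 (fun t => destRx2 C w.1 w.2 t.val) ≠ w.2) = ∅ := by
    refine Finset.filter_eq_empty_iff.2 fun w _ => ?_
    rw [hd1, hd2, not_or, not_not, not_not]
    exact ⟨Function.leftInverse_invFun hS1 w.1, Function.leftInverse_invFun hS2 w.2⟩
  rw [errProb, hempty, Finset.card_empty, Nat.cast_zero, zero_div]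

lemma achievable_of_scheme (hmn : m ≤ n) (h2 : nb ≤ mb) (hc : c = 2 * m - n)
    (hk : c + k1 + k2 ≤ m) (hk' : c + k1 + k2 ≤ n - m) (hk1 : k1 ≤ mb) (hk2 : k2 ≤ mb)
    {r1 r2 : ℕ} (hr1 : r1 ≤ k2 + c + (n - m)) (hr2 : r2 ≤ k1 + c + (n - m)) (hf1 : r1 ≤ f)
    (hf2 : r2 ≤ f) (L : ℕ) :
    Achievable n m f nb mb (r1 * (L / (L + 4))) (r2 * (L / (L + 4))) := by
  refine ⟨by positivity, by positivity, fun ε hε => ⟨L + 4, by omega, ?_⟩⟩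
  have hM : ∀ r : ℕ, ⌈(2 : ℝ) ^ (((L + 4 : ℕ) : ℝ) * (r * (L / (L + 4))))⌉₊ = 2 ^ (L * r) := by
    intro r
    have hexp : ((L + 4 : ℕ) : ℝ) * (r * (L / (L + 4))) = ((L * r : ℕ) : ℝ) := by
      push_cast
      field_simp
    have hpow : (2 : ℝ) ^ (L * r) = ((2 ^ (L * r) : ℕ) : ℝ) := by push_cast; rfl
    rw [hexp, Real.rpow_natCast, hpow, Nat.ceil_natCast]
  rw [hM, hM]
  obtain ⟨C, hC⟩ := exists_code_errProb_eq_zero hmn h2 hc hk hk' hk1 hk2 hr1 hr2 hf1 hf2 L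
  exact ⟨C, hC.trans_le hε.le⟩

/-- For suitable parameters the scheme attains the capacity. -/
lemma exists_achievable (h1 : 3 * m ≤ 2 * n) (h2 : nb ≤ mb) : ∃ r1 r2 : ℕ,
    r1 + r2 = min (2 * max (n - m) m + 2 * mb) (min (2 * n - m) (2 * f)) ∧
    ∀ L : ℕ, Achievable n m f nb mb (r1 * (L / (L + 4))) (r2 * (L / (L + 4))) := by
  obtain ⟨c, hc⟩ : ∃ c, c = 2 * m - n := ⟨_, rfl⟩
  obtain ⟨d, hd⟩ : ∃ d, d = min m (n - m) - c := ⟨_, rfl⟩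
  obtain ⟨k1, hk1⟩ : ∃ k, k = min mb (min (f - max (n - m) m) ((d + 1) / 2)) := ⟨_, rfl⟩
  obtain ⟨k2, hk2⟩ : ∃ k, k = min mb (min (f - max (n - m) m) (d / 2)) := ⟨_, rfl⟩
  refine ⟨min (max (n - m) m) f + k2, min (max (n - m) m) f + k1, by omega,
    achievable_of_scheme (c := c) (k1 := k1) (k2 := k2) (by omega) h2 hc (by omega) (by omega)
      (by omega) (by omega) (by omega) (by omega) (by omega) (by omega)⟩

end Transmission

end TwoHopIC

open TwoHopIC in
/-- Sum capacity in the weak interference regime with dominant backward cross-link. -/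
theorem sumCapacity_weak_crosslink (n m f nb mb : ℕ) (h1 : 3 * m ≤ 2 * n)
    (h2 : nb ≤ mb) :
    sumCapacity n m f nb mb =
      min (2 * max ((n : ℝ) - m) m + 2 * mb) (min (2 * (n : ℝ) - m) (2 * f)) := by
  have hmn : m ≤ n := by omega
  obtain ⟨r1, r2, hr, hach⟩ := exists_achievable (f := f) h1 h2
  have hcast : min (2 * max ((n : ℝ) - m) m + 2 * mb) (min (2 * (n : ℝ) - m) (2 * f)) =
      (r1 : ℝ) + r2 := by
    rw [← Nat.cast_add, hr]
    push_cast [Nat.cast_sub hmn, Nat.cast_sub (show m ≤ 2 * n by omega)]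
    rfl
  refine IsLUB.csSup_eq ⟨?_, fun b hb => ?_⟩ ⟨_, _, _, hach 0, rfl⟩
  · rintro _ ⟨R1, R2, h, rfl⟩
    exact h.add_le_capacity hmn h2
  · rw [hcast]
    refine le_of_tendsto' (f := fun L : ℕ => (r1 : ℝ) * (L / (L + 4)) + r2 * (L / (L + 4)))
      (x := Filter.atTop) ?_ fun L => hb ⟨_, _, hach L, rfl⟩
    simpa using ((tendsto_natCast_div_add_atTop (4 : ℝ)).const_mul (r1 : ℝ)).add
      ((tendsto_natCast_div_add_atTop (4 : ℝ)).const_mul (r2 : ℝ))
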